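/- arXiv:1710.03624 — 7 statements merged into one kernel-verified Lean document; each statement's English description precedes it below -/
import Mathlib

section
/- Let k ≥ 3 be an integer and let χ1, χ2 be Dirichlet characters modulo q1 and q2 with χ1(−1)·χ2(−1) = (−1)^k. For z in the upper half-plane define E_{χ1,χ2,k}(z) = (1/2) · ∑_{(c,d)∈ℤ², gcd(c,d)=1} χ1(c)·χ2(d)·(c·q2·z + d)^{−k} (absolutely convergent since k ≥ 3). Then for every γ = [[a,b],[c,d]] ∈ SL2(ℤ) with q1·q2 ∣ c, one has E_{χ1,χ2,k}((a·z+b)/(c·z+d)) = (c·z + d)^k · (χ1 · conj(χ2))(d) · E_{χ1,χ2,k}(z). -/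
open Complex

/-- The holomorphic Eisenstein series of weight `k` attached to a pair of Dirichlet characters:
`E_{χ1,χ2,k}(z) = (1/2) ∑_{(c,d)=1} χ1(c) χ2(d) (c q2 z + d)^{-k}`. -/
noncomputable def holEisenstein {q1 q2 : ℕ} (k : ℤ)
    (χ1 : DirichletCharacter ℂ q1) (χ2 : DirichletCharacter ℂ q2) (z : ℂ) : ℂ :=
  (1 / 2) * ∑' p : ℤ × ℤ,
    if Int.gcd p.1 p.2 = 1 then
      χ1 p.1 * χ2 p.2 * ((p.1 : ℂ) * q2 * z + p.2) ^ (-k)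
    else 0

/-- An integral unimodular change of variables preserves coprimality. -/
theorem coprime_transform_aux (a e f d m n : ℤ) (hdet : a * d - e * f = 1)
    (h : IsCoprime m n) : IsCoprime (a * m + e * n) (f * m + d * n) := by
  obtain ⟨u, v, huv⟩ := h
  refine ⟨u * d - v * f, v * a - u * e, ?_⟩
  linear_combination (u * m + v * n) * hdet + huv

/-- The change of variables on `ℤ × ℤ` given by a unimodular matrix. -/
def unimodularEquiv (a e f d : ℤ) (hdet : a * d - e * f = 1) : ℤ × ℤ ≃ ℤ × ℤ where
  toFun p := (a * p.1 + e * p.2, f * p.1 + d * p.2)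
  invFun p := (d * p.1 - e * p.2, a * p.2 - f * p.1)
  left_inv p := by
    ext
    · show d * (a * p.1 + e * p.2) - e * (f * p.1 + d * p.2) = p.1
      linear_combination p.1 * hdet
    · show a * (f * p.1 + d * p.2) - f * (a * p.1 + e * p.2) = p.2
      linear_combination p.2 * hdet
  right_inv p := by
    ext
    · show a * (d * p.1 - e * p.2) + e * (a * p.2 - f * p.1) = p.1
      linear_combination p.1 * hdet
    · show f * (d * p.1 - e * p.2) + d * (a * p.2 - f * p.1) = p.2
      linear_combination p.2 * hdet

/-- `E_{χ1,χ2,k}` transforms with weight `k` and nebentypus `χ1 ⬝ conj χ2` under `Γ₀(q1 q2)`. -/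
theorem holEisenstein_automorphy {q1 q2 : ℕ} (k : ℤ) (hk : 3 ≤ k)
    (χ1 : DirichletCharacter ℂ q1) (χ2 : DirichletCharacter ℂ q2)
    (hparity : χ1 (-1) * χ2 (-1) = (-1 : ℂ) ^ k)
    (a b c d : ℤ) (hdet : a * d - b * c = 1) (hc : ((q1 * q2 : ℕ) : ℤ) ∣ c)
    (z : ℂ) (hz : 0 < z.im) :
    holEisenstein k χ1 χ2 (((a : ℂ) * z + b) / ((c : ℂ) * z + d)) =
      ((c : ℂ) * z + d) ^ k * (χ1 d * (starRingEnd ℂ) (χ2 d)) * holEisenstein k χ1 χ2 z := by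
  obtain ⟨t, ht⟩ := hc
  push_cast at ht
  have hdet' : a * d - (q1 * t) * (b * q2) = 1 := by
    rw [← hdet, ht]; ring
  have hJ : (c : ℂ) * z + d ≠ 0 := by
    intro h0
    have him := congrArg Complex.im h0
    have hre := congrArg Complex.re h0
    simp at him hre
    rcases him with h | h
    · subst h
      simp at hre
      subst hre
      simp at hdet
    · exact hz.ne' h
  have hq1 : ((a : ZMod q1) * d) = 1 := by
    have := congrArg (Int.cast : ℤ → ZMod q1) hdet'
    push_cast at this
    simpa using this
  have hq2 : ((a : ZMod q2) * d) = 1 := by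
    have := congrArg (Int.cast : ℤ → ZMod q2) hdet'
    push_cast at this
    simpa using this
  have hχ1 : χ1 a * χ1 d = 1 := by rw [← map_mul, hq1, map_one]
  have hχ2 : (starRingEnd ℂ) (χ2 d) * χ2 d = 1 := by
    have hu : IsUnit (d : ZMod q2) := IsUnit.of_mul_eq_one_right _ hq2
    rw [Complex.conj_mul', ← hu.unit_spec, DirichletCharacter.unit_norm_eq_one]
    simp
  have hcC : (c : ℂ) = q1 * q2 * t := by rw [ht]; push_cast; ring
  unfold holEisenstein
  rw [← (unimodularEquiv a (q1 * t) (b * q2) d hdet').tsum_eq (fun p : ℤ × ℤ =>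
    if Int.gcd p.1 p.2 = 1 then
      χ1 p.1 * χ2 p.2 * ((p.1 : ℂ) * q2 * z + p.2) ^ (-k)
    else 0), mul_left_comm _ (1 / 2 : ℂ)]
  refine congrArg (fun x : ℂ => 1 / 2 * x) ?_
  rw [← tsum_mul_left (a := ((c : ℂ) * z + d) ^ k * (χ1 d * (starRingEnd ℂ) (χ2 d)))]
  refine tsum_congr fun p => ?_
  obtain ⟨m, n⟩ := p
  have hg : Int.gcd (a * m + q1 * t * n) (b * q2 * m + d * n) = 1 ↔ Int.gcd m n = 1 := by
    rw [← Int.isCoprime_iff_gcd_eq_one, ← Int.isCoprime_iff_gcd_eq_one]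
    refine ⟨fun h => ?_, coprime_transform_aux a (q1 * t) (b * q2) d m n hdet'⟩
    have h2 := coprime_transform_aux d (-(q1 * t)) (-(b * q2)) a _ _
      (by linear_combination hdet') h
    convert h2 using 1
    · linear_combination (-m) * hdet'
    · linear_combination (-n) * hdet'
  simp only [unimodularEquiv, Equiv.coe_fn_mk, hg]
  split_ifs with hmn
  · have e1 : χ1 ((a * m + q1 * t * n : ℤ) : ZMod q1) = χ1 a * χ1 m := by
      rw [← map_mul]; congr 1; push_cast; simp
    have e2 : χ2 ((b * q2 * m + d * n : ℤ) : ZMod q2) = χ2 d * χ2 n := by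
      rw [← map_mul]; congr 1; push_cast; simp
    have e3 : (m : ℂ) * q2 * ((a * z + b) / (c * z + d)) + n =
        (((a * m + q1 * t * n : ℤ) : ℂ) * q2 * z + ((b * q2 * m + d * n : ℤ) : ℂ)) /
          (c * z + d) := by
      rw [eq_div_iff hJ, add_mul, mul_assoc, div_mul_cancel₀ _ hJ]
      push_cast
      rw [hcC]
      ring
    rw [e1, e2, e3, div_zpow, zpow_neg (_ + _) k, zpow_neg ((c : ℂ) * z + d) k, div_inv_eq_mul]
    generalize (((a * m + q1 * t * n : ℤ) : ℂ) * q2 * z + ((b * q2 * m + d * n : ℤ) : ℂ)) ^ k = X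
    generalize ((c : ℂ) * z + d) ^ k = Y
    calc χ1 m * χ2 n * (X⁻¹ * Y)
        = (χ1 a * χ1 d) * ((starRingEnd ℂ) (χ2 d) * χ2 d) * (χ1 m * χ2 n * (X⁻¹ * Y)) := by
          rw [hχ1, hχ2]; ring
      _ = _ := by ring
  · simp
end

section
/- Let χ1, χ2 be Dirichlet characters modulo q1 and q2, and let s, u ∈ ℂ with Re(u) > 1 + |Re(s) − 1/2|. Then the Dirichlet series ∑_{n=1}^{∞} λ_{χ1,χ2}(n, s) · n^{−u} converges and equals L(u + s − 1/2, χ1) · L(u + 1/2 − s, conj(χ2)), where L(·, χ) denotes the Dirichlet L-function of χ. -/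
open Complex

/-- The Fourier coefficient `λ_{χ1,χ2}(n,s) = χ2(sgn n) ∑_{ab=|n|} χ1(a) conj(χ2)(b)
(b/a)^{s-1/2}`. -/
noncomputable def lambdaChiChi {q1 q2 : ℕ}
    (χ1 : DirichletCharacter ℂ q1) (χ2 : DirichletCharacter ℂ q2) (n : ℤ) (s : ℂ) : ℂ :=
  (if 0 < n then 1 else χ2 (-1)) *
    ∑ b ∈ n.natAbs.divisors,
      χ1 ((n.natAbs / b : ℕ)) * (starRingEnd ℂ) (χ2 b) *
        ((b : ℂ) / ((n.natAbs / b : ℕ) : ℂ)) ^ (s - 1 / 2)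

/-- Dirichlet series `L(w,χ) = ∑_{n ≥ 1} χ(n) n^{-w}` (convergent for `Re w > 1`). -/
noncomputable def LSer {q : ℕ} (χ : DirichletCharacter ℂ q) (w : ℂ) : ℂ :=
  ∑' n : ℕ, χ n * (n : ℂ) ^ (-w)

/-- `LSeries.term` of a twisted character. -/
lemma term_twist {q : ℕ} (χ : DirichletCharacter ℂ q) (t u : ℂ) (hu : 1 < (u + t).re) (n : ℕ) :
    LSeries.term (fun n : ℕ => χ n * (n : ℂ) ^ (-t)) u n = χ n * (n : ℂ) ^ (-(u + t)) := by
  rcases eq_or_ne n 0 with rfl | hn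
  · have h0 : -(u + t) ≠ 0 := by
      intro h
      rw [neg_eq_zero] at h
      rw [h] at hu
      simp at hu
      linarith
    rw [LSeries.term_zero, Nat.cast_zero, Nat.cast_zero, zero_cpow h0, mul_zero]
  · have hn' : (n : ℂ) ≠ 0 := Nat.cast_ne_zero.mpr hn
    rw [LSeries.term_of_ne_zero hn, neg_add, add_comm, cpow_add _ _ hn', cpow_neg _ u]
    ring

lemma hasSum_twist {q : ℕ} (χ : DirichletCharacter ℂ q) (t u : ℂ) (hu : 1 < (u + t).re) :
    LSeriesHasSum (fun n : ℕ => χ n * (n : ℂ) ^ (-t)) u (LSer χ (u + t)) := by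
  have h := DirichletCharacter.LSeriesSummable_of_one_lt_re χ hu
  have h2 : LSeries.term (fun n : ℕ => χ n) (u + t) = fun n : ℕ => χ n * (n : ℂ) ^ (-(u + t)) := by
    funext n
    have := term_twist χ 0 (u + t) (by simpa using hu) n
    simpa using this
  unfold LSeriesSummable at h
  rw [h2] at h
  unfold LSeriesHasSum
  rw [show LSeries.term (fun n : ℕ => χ n * (n : ℂ) ^ (-t)) u = _ from
    funext (term_twist χ t u hu)]
  exact h.hasSum

lemma natCast_mul_inv_cpow (b a : ℕ) (t : ℂ) :
    ((b : ℂ) * (a : ℂ)⁻¹) ^ t = (b : ℂ) ^ t * ((a : ℂ) ^ t)⁻¹ := by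
  have h1 : (b : ℂ) = ((b : ℝ) : ℂ) := by simp
  have h2 : (a : ℂ)⁻¹ = (((a : ℝ)⁻¹ : ℝ) : ℂ) := by simp
  rw [h1, h2, mul_cpow_ofReal_nonneg (by positivity) (by positivity), ← h2,
    inv_cpow _ _ (by rw [natCast_arg]; exact Real.pi_pos.ne)]

/-- `∑_{n ≥ 1} λ_{χ1,χ2}(n,s) n^{-u} = L(u+s-1/2, χ1) L(u+1/2-s, conj χ2)`. -/
theorem lambdaChiChi_dirichletSeries {q1 q2 : ℕ}
    (χ1 : DirichletCharacter ℂ q1) (χ2 : DirichletCharacter ℂ q2)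
    (s u : ℂ) (hu : 1 + |s.re - 1 / 2| < u.re) :
    HasSum (fun n : ℕ => lambdaChiChi χ1 χ2 ((n : ℤ) + 1) s * (((n : ℂ) + 1) ^ (-u)))
      (LSer χ1 (u + s - 1 / 2) * LSer (χ2.ringHomComp (starRingEnd ℂ)) (u + 1 / 2 - s)) := by
  have hA : 1 < (u + (s - 1 / 2)).re := by
    have := neg_abs_le (s.re - 1 / 2)
    simp only [add_re, sub_re]
    norm_num
    norm_num at this hu
    linarith
  have hB : 1 < (u + (-(s - 1 / 2))).re := by
    have := le_abs_self (s.re - 1 / 2)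
    simp only [add_re, sub_re, neg_re]
    norm_num
    norm_num at this hu
    linarith
  have H := (hasSum_twist χ1 _ u hA).convolution
    (hasSum_twist (χ2.ringHomComp (starRingEnd ℂ)) _ u hB)
  rw [show u + s - 1 / 2 = u + (s - 1 / 2) by ring,
    show u + 1 / 2 - s = u + (-(s - 1 / 2)) by ring]
  unfold LSeriesHasSum at H
  rw [← hasSum_nat_add_iff' 1] at H
  simp only [Finset.range_one, Finset.sum_singleton, LSeries.term_zero, sub_zero] at H
  refine H.congr_fun ?_
  intro n
  rw [LSeries.term_of_ne_zero (Nat.succ_ne_zero n), LSeries.convolution_def]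
  have habs : ((n : ℤ) + 1).natAbs = n + 1 := by omega
  have hpos : (0 : ℤ) < (n : ℤ) + 1 := by omega
  unfold lambdaChiChi
  generalize s - 1 / 2 = t
  rw [if_pos hpos, one_mul, habs, cpow_neg, div_eq_mul_inv]
  push_cast
  congr 1
  rw [Nat.sum_divisorsAntidiagonal' (f := fun a b : ℕ => χ1 a * (a : ℂ) ^ (-t) *
    ((χ2.ringHomComp (starRingEnd ℂ)) b * (b : ℂ) ^ (- -t)))]
  refine Finset.sum_congr rfl fun b _ => ?_
  rw [neg_neg, cpow_neg, div_eq_mul_inv, natCast_mul_inv_cpow]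
  rw [MulChar.ringHomComp_apply]
  ring
end

section
/- Let ψ be a Dirichlet character modulo N, let f be a positive divisor of N, let u be an integer with gcd(u, N) = 1, and set d = gcd(f, N/f). Then ψ(1 + u·(N/d)·t) = 1 for all integers t if and only if ψ factors through modulus N/d, i.e. there exists a Dirichlet character modulo N/d that induces ψ. (Note that 1 + u·(N/d)·t is automatically coprime to N, since d² divides N.) Equivalently, the cusp 1/(u·f) of Γ0(N) is singular for ψ if and only if the conductor of ψ divides N/gcd(f, N/f) = lcm(f, N/f). -/
open Complex

lemma singular_aux {N M : ℕ} (hN : 0 < N) (ψ : DirichletCharacter ℂ N) (hM : M ∣ N)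
    (hM2 : N ∣ M * M) (u : ℤ) (hu : Int.gcd u (N : ℤ) = 1) :
    (∀ t : ℤ, ψ (((1 + u * (M : ℤ) * t : ℤ) : ZMod N)) = 1) ↔
      ∃ χ0 : DirichletCharacter ℂ M, ψ = DirichletCharacter.changeLevel hM χ0 := by
  haveI : NeZero N := ⟨hN.ne'⟩
  constructor
  · intro h
    have hF : DirichletCharacter.FactorsThrough ψ M := by
      rw [DirichletCharacter.factorsThrough_iff_ker_unitsMap hM]
      intro v hv
      rw [MonoidHom.mem_ker] at hv ⊢
      obtain ⟨a, ha⟩ := ZMod.intCast_surjective (v : ZMod N)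
      have h1 : ((a : ℤ) : ZMod M) = ((1 : ℤ) : ZMod M) := by
        have := congrArg Units.val hv
        rw [ZMod.unitsMap_val, ← ha] at this
        rw [ZMod.cast_intCast hM] at this
        simpa using this
      rw [eq_comm, ZMod.intCast_eq_intCast_iff_dvd_sub] at h1
      obtain ⟨k, hk⟩ := h1
      obtain ⟨s, r, hsr⟩ := Int.isCoprime_iff_gcd_eq_one.mpr hu
      have h2 : ((1 + u * (M : ℤ) * (s * k) : ℤ) : ZMod N) = (v : ZMod N) := by
        rw [← ha, ZMod.intCast_eq_intCast_iff_dvd_sub]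
        refine ⟨r * M * k, ?_⟩
        linear_combination hk - (M : ℤ) * k * hsr
      have h3 := h (s * k)
      rw [h2] at h3
      ext
      simpa using h3
    exact ⟨hF.χ₀, hF.eq_changeLevel⟩
  · rintro ⟨χ, rfl⟩ t
    obtain ⟨c, hc⟩ := hM2
    have hc' : (M : ℤ) * M = N * c := by exact_mod_cast hc
    have hco : IsCoprime (1 + u * (M : ℤ) * t) (N : ℤ) :=
      ⟨1 - u * M * t, c * (u * t) ^ 2, by linear_combination -(u * t) ^ 2 * hc'⟩
    rw [DirichletCharacter.changeLevel_eq_cast_of_dvd' _ _ hco]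
    simp

/-- The cusp `1/(u f)` of `Γ₀(N)` is singular for `ψ` (i.e. `ψ(1 + u (N/(f,N/f)) t) = 1` for all
`t`) if and only if `ψ` factors through modulus `N / gcd(f, N/f)`. -/
theorem singular_cusp_iff {N : ℕ} (hN : 0 < N) (ψ : DirichletCharacter ℂ N)
    (f : ℕ) (hf : f ∣ N) (u : ℤ) (hu : Int.gcd u (N : ℤ) = 1) :
    (∀ t : ℤ, ψ (((1 + u * ((N / Nat.gcd f (N / f) : ℕ) : ℤ) * t : ℤ) : ZMod N)) = 1) ↔
      ∃ χ0 : DirichletCharacter ℂ (N / Nat.gcd f (N / f)),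
        ψ = DirichletCharacter.changeLevel
          (Nat.div_dvd_of_dvd ((Nat.gcd_dvd_left f (N / f)).trans hf)) χ0 := by
  refine singular_aux hN ψ _ ?_ u hu
  have hdN := (Nat.gcd_dvd_left f (N / f)).trans hf
  have h2 : Nat.gcd f (N / f) * Nat.gcd f (N / f) ∣ N := by
    have := Nat.mul_dvd_mul (Nat.gcd_dvd_left f (N / f)) (Nat.gcd_dvd_right f (N / f))
    rwa [Nat.mul_div_cancel' hf] at this
  have h3 := Nat.dvd_div_of_mul_dvd h2
  have h4 := Nat.mul_dvd_mul_right h3 (N / Nat.gcd f (N / f))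
  rwa [Nat.mul_div_cancel' hdN] at h4
end

section
/- Let ω1, ω2 : ℕ → ℂ be completely multiplicative functions, let L be a positive integer, and let K be a complex-valued function defined on the divisors of L. For each g ∣ L define J(g) = ∑_{a ∣ g} ∑_{b ∣ L/g} μ(a)·μ(b)·ω2(a)·ω1(b)·K(b·g/a). Then for every factorization L = A·B one has K(B) · ∏_{p ∣ L, p prime} (1 − ω1(p)·ω2(p)) = ∏_{p ∣ L} (1 − ω1(p)·ω2(p)) · ∑_{d ∣ A} ∑_{e ∣ B, gcd(d,e)=1} ω1(d)·ω2(e)·J(B·d/e) · ∏_{p ∣ L}(1 − ω1(p)ω2(p))^{-1}; equivalently, in cross-multiplied form, K(B) · ∏_{p ∣ L} (1 − ω1(p)·ω2(p)) = ∑_{d ∣ A} ∑_{e ∣ B, gcd(d,e)=1} ω1(d)·ω2(e)·J(B·d/e). -/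
open ArithmeticFunction

/-- The common shape of both transforms. -/
noncomputable def invU (w : ℕ → ℕ → ℂ) (A B : ℕ) (F : ℕ → ℂ) : ℂ :=
  ∑ d ∈ A.divisors, ∑ e ∈ B.divisors, w d e * F (d * B / e)

/-- Multiplicativity of a two-variable weight. -/
def invMul (w : ℕ → ℕ → ℂ) : Prop :=
  ∀ d1 d2 e1 e2 : ℕ, Nat.Coprime (d1 * e1) (d2 * e2) →
    w (d1 * d2) (e1 * e2) = w d1 e1 * w d2 e2

lemma invU_congr (w : ℕ → ℕ → ℂ) (A B : ℕ) (F G : ℕ → ℂ)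
    (h : ∀ g, g ∣ A * B → F g = G g) : invU w A B F = invU w A B G := by
  unfold invU
  refine Finset.sum_congr rfl fun d hd => Finset.sum_congr rfl fun e he => ?_
  rw [h]
  have hd := Nat.dvd_of_mem_divisors hd
  have he := Nat.dvd_of_mem_divisors he
  rw [Nat.mul_div_assoc _ he]
  exact mul_dvd_mul hd (Nat.div_dvd_of_dvd he)

lemma invU_mul_const (w : ℕ → ℕ → ℂ) (A B : ℕ) (F : ℕ → ℂ) (c : ℂ) :
    invU w A B (fun x => F x * c) = invU w A B F * c := by
  simp only [invU, Finset.sum_mul, mul_assoc]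

lemma invU_eq (w : ℕ → ℕ → ℂ) (A B : ℕ) (F : ℕ → ℂ) :
    invU w A B F = ∑ x ∈ A.divisors ×ˢ B.divisors, w x.1 x.2 * F (x.1 * B / x.2) := by
  rw [Finset.sum_product, invU]

lemma invU_comm (w v : ℕ → ℕ → ℂ) (A B C D : ℕ) (F : ℕ → ℕ → ℂ) :
    invU w A B (fun x => invU v C D (fun y => F x y)) =
      invU v C D (fun y => invU w A B (fun x => F x y)) := by
  simp only [invU_eq, Finset.mul_sum]
  rw [Finset.sum_comm]
  refine Finset.sum_congr rfl fun d hd => Finset.sum_congr rfl fun e he => ?_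
  ring

lemma inv_sum_divisors (m n : ℕ) (h : Nat.Coprime m n) (f : ℕ → ℂ) :
    ∑ d ∈ (m * n).divisors, f d = ∑ x ∈ m.divisors, ∑ y ∈ n.divisors, f (x * y) := by
  rw [Nat.divisors_mul, Finset.mul_def, Finset.sum_image h.mul_injOn_divisors,
    Finset.sum_product]

lemma invU_split (w : ℕ → ℕ → ℂ) (hw : invMul w) (A1 A2 B1 B2 : ℕ)
    (h : Nat.Coprime (A1 * B1) (A2 * B2)) (F : ℕ → ℂ) :
    invU w (A1 * A2) (B1 * B2) F =
      invU w A1 B1 (fun x => invU w A2 B2 (fun y => F (x * y))) := by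
  have hA : Nat.Coprime A1 A2 := (h.coprime_mul_right).coprime_mul_right_right
  have hB : Nat.Coprime B1 B2 := (h.coprime_mul_left).coprime_mul_left_right
  unfold invU
  rw [inv_sum_divisors _ _ hA]
  refine Finset.sum_congr rfl fun d1 hd1 => ?_
  simp only [Finset.mul_sum]
  rw [Finset.sum_comm]
  rw [Finset.sum_comm]
  conv_rhs => rw [Finset.sum_comm]
  refine Finset.sum_congr rfl fun d2 hd2 => ?_
  rw [inv_sum_divisors _ _ hB]
  refine Finset.sum_congr rfl fun e1 he1 => Finset.sum_congr rfl fun e2 he2 => ?_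
  have hd1 := Nat.dvd_of_mem_divisors hd1
  have hd2 := Nat.dvd_of_mem_divisors hd2
  have he1 := Nat.dvd_of_mem_divisors he1
  have he2 := Nat.dvd_of_mem_divisors he2
  rw [hw d1 d2 e1 e2 (Nat.Coprime.of_dvd (mul_dvd_mul hd1 he1) (mul_dvd_mul hd2 he2) h)]
  rw [show d1 * d2 * (B1 * B2) = (d1 * B1) * (d2 * B2) by ring,
    Nat.mul_div_mul_comm (he1.mul_left d1) (he2.mul_left d2)]
  ring

/-- Telescoping pieces of the prime power case. -/
noncomputable def invT (x y : ℂ) (k : ℕ → ℂ) : ℕ → ℕ → ℂ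
  | 0, 0 => k 0
  | 0, m + 1 => k (m + 1) - y * k m
  | _ + 1, 0 => k 0 - x * k 1
  | _ + 1, m + 1 => (1 + x * y) * k (m + 1) - y * k m - x * k (m + 2)

lemma invT_right (x y : ℂ) (k : ℕ → ℂ) (u : ℕ) : ∀ m,
    ∑ i ∈ Finset.range (u + 1), x ^ (i + 1) * invT x y k (u - i) (m + 1 + i) =
      x * k (m + 1) - x * y * k m := by
  induction u with
  | zero => intro m; simp [invT]; ring
  | succ u ih =>
    intro m
    rw [Finset.sum_range_succ']
    have : ∀ i ∈ Finset.range (u + 1), x ^ (i + 1 + 1) *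
        invT x y k (u + 1 - (i + 1)) (m + 1 + (i + 1)) =
        x * (x ^ (i + 1) * invT x y k (u - i) (m + 1 + 1 + i)) := by
      intro i _
      rw [show u + 1 - (i + 1) = u - i by omega, show m + 1 + (i + 1) = m + 1 + 1 + i by omega]
      ring
    rw [Finset.sum_congr rfl this, ← Finset.mul_sum, ih]
    simp [invT]
    ring

lemma invT_left (x y : ℂ) (k : ℕ → ℂ) (m : ℕ) : ∀ u,
    ∑ j ∈ Finset.range (m + 1), y ^ (j + 1) * invT x y k (u + 1 + j) (m - j) =
      y * k m - x * y * k (m + 1) := by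
  induction m with
  | zero => intro u; simp [invT]; ring
  | succ m ih =>
    intro u
    rw [Finset.sum_range_succ']
    have : ∀ j ∈ Finset.range (m + 1), y ^ (j + 1 + 1) *
        invT x y k (u + 1 + (j + 1)) (m + 1 - (j + 1)) =
        y * (y ^ (j + 1) * invT x y k (u + 1 + 1 + j) (m - j)) := by
      intro i _
      rw [show m + 1 - (i + 1) = m - i by omega, show u + 1 + (i + 1) = u + 1 + 1 + i by omega]
      ring
    rw [Finset.sum_congr rfl this, ← Finset.mul_sum, ih]
    simp [invT]
    ring

lemma invT_total (x y : ℂ) (k : ℕ → ℂ) (u m : ℕ) (h : 0 < u + m) :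
    invT x y k u m
      + ∑ i ∈ Finset.range u, x ^ (i + 1) * invT x y k (u - (i + 1)) (m + (i + 1))
      + ∑ j ∈ Finset.range m, y ^ (j + 1) * invT x y k (u + (j + 1)) (m - (j + 1))
      = k m * (1 - x * y) := by
  have hr : ∀ u, ∑ i ∈ Finset.range (u + 1),
      x ^ (i + 1) * invT x y k (u + 1 - (i + 1)) (m + (i + 1)) =
      x * k (m + 1) - x * y * k m := by
    intro u
    rw [← invT_right x y k u m]
    refine Finset.sum_congr rfl fun i _ => ?_
    rw [show u + 1 - (i + 1) = u - i by omega, show m + (i + 1) = m + 1 + i by omega]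
  have hl : ∀ m, ∑ j ∈ Finset.range (m + 1),
      y ^ (j + 1) * invT x y k (u + (j + 1)) (m + 1 - (j + 1)) =
      y * k m - x * y * k (m + 1) := by
    intro m
    rw [← invT_left x y k m u]
    refine Finset.sum_congr rfl fun i _ => ?_
    rw [show m + 1 - (i + 1) = m - i by omega, show u + (i + 1) = u + 1 + i by omega]
  rcases u with _ | u <;> rcases m with _ | m
  · omega
  · rw [hl]; simp [invT]; ring
  · rw [hr]; simp [invT]; ring
  · rw [hl, hr]; simp [invT]; ring

/-- Moebius weight. -/
noncomputable def invW (ω1 ω2 : ℕ → ℂ) (b a : ℕ) : ℂ :=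
  (moebius a : ℂ) * (moebius b : ℂ) * ω2 a * ω1 b

/-- Coprime weight. -/
noncomputable def invV (ω1 ω2 : ℕ → ℂ) (d e : ℕ) : ℂ :=
  if Nat.gcd d e = 1 then ω1 d * ω2 e else 0

lemma invW_mul (ω1 ω2 : ℕ → ℂ)
    (h1 : ∀ m n : ℕ, ω1 (m * n) = ω1 m * ω1 n)
    (h2 : ∀ m n : ℕ, ω2 (m * n) = ω2 m * ω2 n) : invMul (invW ω1 ω2) := by
  intro d1 d2 e1 e2 h
  have hA : Nat.Coprime d1 d2 := (h.coprime_mul_right).coprime_mul_right_right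
  have hB : Nat.Coprime e1 e2 := (h.coprime_mul_left).coprime_mul_left_right
  unfold invW
  rw [isMultiplicative_moebius.map_mul_of_coprime hA,
    isMultiplicative_moebius.map_mul_of_coprime hB, h1, h2]
  push_cast
  ring

lemma invV_mul (ω1 ω2 : ℕ → ℂ)
    (h1 : ∀ m n : ℕ, ω1 (m * n) = ω1 m * ω1 n)
    (h2 : ∀ m n : ℕ, ω2 (m * n) = ω2 m * ω2 n) : invMul (invV ω1 ω2) := by
  intro d1 d2 e1 e2 h
  have hA : Nat.Coprime d1 e2 := (h.coprime_mul_right).coprime_mul_left_right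
  have hB : Nat.Coprime e1 d2 := (h.coprime_mul_left).coprime_mul_right_right
  have key : Nat.gcd (d1 * d2) (e1 * e2) = 1 ↔ Nat.gcd d1 e1 = 1 ∧ Nat.gcd d2 e2 = 1 := by
    change Nat.Coprime _ _ ↔ Nat.Coprime _ _ ∧ Nat.Coprime _ _
    rw [Nat.coprime_mul_iff_left, Nat.coprime_mul_iff_right, Nat.coprime_mul_iff_right]
    have := hB.symm
    tauto
  unfold invV
  by_cases c1 : Nat.gcd d1 e1 = 1 <;> by_cases c2 : Nat.gcd d2 e2 = 1 <;>
    simp [key, c1, c2, h1, h2]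
  ring

lemma inv_moebius_sum (p : ℕ) (hp : p.Prime) (u : ℕ) (f : ℕ → ℂ) :
    ∑ i ∈ Finset.range (u + 1), (moebius (p ^ i) : ℂ) * f i =
      f 0 - if u = 0 then 0 else f 1 := by
  rcases u with _ | u
  · simp
  · rw [Finset.sum_range_succ', Finset.sum_range_succ']
    rw [Finset.sum_eq_zero]
    · simp [moebius_apply_prime hp]; ring
    · intro i _
      rw [moebius_apply_prime_pow hp (by omega)]
      simp

lemma invU_prime_pow (w : ℕ → ℕ → ℂ) (p : ℕ) (hp : p.Prime) (u m : ℕ) (F : ℕ → ℂ) :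
    invU w (p ^ u) (p ^ m) F = ∑ i ∈ Finset.range (u + 1), ∑ j ∈ Finset.range (m + 1),
      w (p ^ i) (p ^ j) * F (p ^ (i + m - j)) := by
  unfold invU
  rw [Nat.sum_divisors_prime_pow hp]
  refine Finset.sum_congr rfl fun i _ => ?_
  rw [Nat.sum_divisors_prime_pow hp]
  refine Finset.sum_congr rfl fun j hj => ?_
  have := Finset.mem_range.1 hj
  rw [← pow_add, Nat.pow_div (by omega) hp.pos]

lemma inv_cm_pow (ω : ℕ → ℂ) (h1 : ω 1 = 1) (h : ∀ m n : ℕ, ω (m * n) = ω m * ω n)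
    (p i : ℕ) : ω (p ^ i) = ω p ^ i := by
  induction i with
  | zero => simp [h1]
  | succ i ih => rw [pow_succ, h, ih, pow_succ]

lemma invU_W_prime_pow (ω1 ω2 : ℕ → ℂ) (hω1 : ω1 1 = 1) (hω2 : ω2 1 = 1)
    (p : ℕ) (hp : p.Prime) (u m : ℕ) (K : ℕ → ℂ) :
    invU (invW ω1 ω2) (p ^ u) (p ^ m) K =
      invT (ω1 p) (ω2 p) (fun i => K (p ^ i)) u m := by
  rw [invU_prime_pow _ _ hp]
  have : ∀ i ∈ Finset.range (u + 1), ∑ j ∈ Finset.range (m + 1),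
      invW ω1 ω2 (p ^ i) (p ^ j) * K (p ^ (i + m - j)) =
      (moebius (p ^ i) : ℂ) * (ω1 (p ^ i) * ∑ j ∈ Finset.range (m + 1),
        (moebius (p ^ j) : ℂ) * (ω2 (p ^ j) * K (p ^ (i + m - j)))) := by
    intro i _
    rw [Finset.mul_sum, Finset.mul_sum]
    refine Finset.sum_congr rfl fun j _ => ?_
    unfold invW
    ring
  rw [Finset.sum_congr rfl this]
  simp only [inv_moebius_sum p hp]
  rcases u with _ | u <;> rcases m with _ | m <;> simp [invT, hω1, hω2]
  rw [show 1 + (m + 1) = m + 2 by omega]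
  ring

lemma inv_main (ω1 ω2 : ℕ → ℂ)
    (hω1 : ω1 1 = 1) (hω1mul : ∀ m n : ℕ, ω1 (m * n) = ω1 m * ω1 n)
    (hω2 : ω2 1 = 1) (hω2mul : ∀ m n : ℕ, ω2 (m * n) = ω2 m * ω2 n) (L : ℕ) :
    0 < L → ∀ (K : ℕ → ℂ) (A B : ℕ), A * B = L →
    invU (invV ω1 ω2) A B (fun g => invU (invW ω1 ω2) (L / g) g K) =
      K B * ∏ p ∈ L.primeFactors, (1 - ω1 p * ω2 p) := by
  induction L using Nat.recOnPosPrimePosCoprime with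
  | zero => intro h; omega
  | one =>
    intro _ K A B h
    obtain ⟨rfl, rfl⟩ := mul_eq_one.1 h
    simp [invU, invV, invW, hω1, hω2]
  | prime_pow p n hp hn =>
    intro _ K A B h
    obtain ⟨u, -, rfl⟩ := (Nat.dvd_prime_pow hp).1 (Dvd.intro _ h)
    obtain ⟨m, -, rfl⟩ := (Nat.dvd_prime_pow hp).1 (Dvd.intro_left _ h)
    rw [← pow_add] at h
    have hum : u + m = n := Nat.pow_right_injective hp.two_le h
    rw [Nat.primeFactors_prime_pow hn.ne' hp, Finset.prod_singleton]
    have ht := invT_total (ω1 p) (ω2 p) (fun i => K (p ^ i)) u m (by omega)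
    rw [← ht]
    rw [invU_prime_pow _ _ hp]
    have hT : ∀ i ≤ n, invU (invW ω1 ω2) (p ^ n / p ^ i) (p ^ i) K =
        invT (ω1 p) (ω2 p) (fun i => K (p ^ i)) (n - i) i := by
      intro i hi
      rw [Nat.pow_div hi hp.pos, invU_W_prime_pow ω1 ω2 hω1 hω2 p hp]
    have hV0 : ∀ i, invV ω1 ω2 (p ^ i) (p ^ 0) = ω1 p ^ i := by
      intro i
      simp [invV, hω2, inv_cm_pow ω1 hω1 hω1mul]
    have hV1 : ∀ j, invV ω1 ω2 (p ^ 0) (p ^ j) = ω2 p ^ j := by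
      intro i
      simp [invV, hω1, inv_cm_pow ω2 hω2 hω2mul]
    have hV2 : ∀ i j, invV ω1 ω2 (p ^ (i + 1)) (p ^ (j + 1)) = 0 := by
      intro i j
      unfold invV
      rw [if_neg]
      intro hc
      have : p ∣ Nat.gcd (p ^ (i + 1)) (p ^ (j + 1)) :=
        Nat.dvd_gcd (dvd_pow_self _ (by omega)) (dvd_pow_self _ (by omega))
      rw [hc] at this
      exact hp.one_lt.ne' (Nat.dvd_one.1 this)
    rw [Finset.sum_range_succ']
    simp only [Finset.sum_range_succ' _ m, hV0, hV1, hV2, zero_mul, Finset.sum_const_zero,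
      zero_add]
    have e1 : ∀ i ∈ Finset.range u, ω1 p ^ (i + 1) * invU (invW ω1 ω2)
        (p ^ n / p ^ (i + 1 + m - 0)) (p ^ (i + 1 + m - 0)) K =
        ω1 p ^ (i + 1) * invT (ω1 p) (ω2 p) (fun i => K (p ^ i)) (u - (i + 1)) (m + (i + 1)) := by
      intro i hi
      have := Finset.mem_range.1 hi
      rw [hT _ (by omega), show n - (i + 1 + m - 0) = u - (i + 1) by omega,
        show i + 1 + m - 0 = m + (i + 1) by omega]
    have e2 : ∀ j ∈ Finset.range m, ω2 p ^ (j + 1) * invU (invW ω1 ω2)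
        (p ^ n / p ^ (m - (j + 1))) (p ^ (m - (j + 1))) K =
        ω2 p ^ (j + 1) * invT (ω1 p) (ω2 p) (fun i => K (p ^ i)) (u + (j + 1)) (m - (j + 1)) := by
      intro i hi
      have := Finset.mem_range.1 hi
      rw [hT _ (by omega), show n - (m - (i + 1)) = u + (i + 1) by omega]
    rw [Finset.sum_congr rfl e1, Finset.sum_congr rfl e2, hT _ (by omega),
      show n - (m - 0) = u by omega]
    simp only [Nat.sub_zero, pow_zero, one_mul]
    ring
  | coprime L1 L2 hL1 hL2 hc ih1 ih2 =>
    intro _ K A B h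
    obtain ⟨A1, A2, B1, B2, rfl, rfl, h1, h2⟩ : ∃ A1 A2 B1 B2, A = A1 * A2 ∧ B = B1 * B2 ∧
        A1 * B1 = L1 ∧ A2 * B2 = L2 := by
      have hA : A = Nat.gcd A L1 * Nat.gcd A L2 := by
        rw [← hc.gcd_mul, Nat.gcd_eq_left (Dvd.intro _ h)]
      have hB : B = Nat.gcd B L1 * Nat.gcd B L2 := by
        rw [← hc.gcd_mul, Nat.gcd_eq_left (Dvd.intro_left _ h)]
      refine ⟨_, _, _, _, hA, hB, ?_⟩
      have hprod : (A.gcd L1 * B.gcd L1) * (A.gcd L2 * B.gcd L2) = L1 * L2 := by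
        calc _ = (A.gcd L1 * A.gcd L2) * (B.gcd L1 * B.gcd L2) := by ring
          _ = _ := by rw [← hA, ← hB, h]
      have d1 : A.gcd L1 * B.gcd L1 ∣ L1 := by
        refine Nat.Coprime.dvd_of_dvd_mul_right ?_ (Dvd.intro _ hprod)
        exact Nat.Coprime.mul_left (hc.coprime_dvd_left (Nat.gcd_dvd_right _ _))
          (hc.coprime_dvd_left (Nat.gcd_dvd_right _ _))
      have d2 : A.gcd L2 * B.gcd L2 ∣ L2 := by
        refine Nat.Coprime.dvd_of_dvd_mul_left ?_ (Dvd.intro_left _ hprod)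
        exact Nat.Coprime.mul_left (hc.symm.coprime_dvd_left (Nat.gcd_dvd_right _ _))
          (hc.symm.coprime_dvd_left (Nat.gcd_dvd_right _ _))
      have l1 := Nat.le_of_dvd (by omega) d1
      have l2 := Nat.le_of_dvd (by omega) d2
      constructor
      · refine le_antisymm l1 (Nat.le_of_mul_le_mul_right (c := L2) ?_ (by omega))
        rw [← hprod]
        exact Nat.mul_le_mul_left _ l2
      · refine le_antisymm l2 (Nat.le_of_mul_le_mul_left (c := L1) ?_ (by omega))
        rw [← hprod]
        exact Nat.mul_le_mul_right _ l1
    have hcc : Nat.Coprime (A1 * B1) (A2 * B2) := by rw [h1, h2]; exact hc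
    rw [invU_split _ (invV_mul ω1 ω2 hω1mul hω2mul) _ _ _ _ hcc]
    have step : ∀ x, x ∣ A1 * B1 →
        invU (invV ω1 ω2) A2 B2
          (fun y => invU (invW ω1 ω2) (L1 * L2 / (x * y)) (x * y) K) =
        invU (invW ω1 ω2) (L1 / x) x (fun x' => K (x' * B2)) *
          ∏ p ∈ L2.primeFactors, (1 - ω1 p * ω2 p) := by
      intro x hx
      rw [h1] at hx
      rw [invU_congr _ _ _ _ (fun y => invU (invW ω1 ω2) (L1 / x) x
        (fun x' => invU (invW ω1 ω2) (L2 / y) y (fun y' => K (x' * y'))))]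
      · rw [invU_comm, ← invU_mul_const]
        congr 1
        funext x'
        exact ih2 (by omega) (fun y' => K (x' * y')) A2 B2 h2
      · intro y hy
        rw [h2] at hy
        rw [Nat.mul_div_mul_comm hx hy, invU_split _ (invW_mul ω1 ω2 hω1mul hω2mul)]
        rw [Nat.div_mul_cancel hx, Nat.div_mul_cancel hy]
        exact hc
    rw [invU_congr _ _ _ _ _ step, invU_mul_const,
      ih1 (by omega) (fun x' => K (x' * B2)) A1 B1 h1, hc.primeFactors_mul,
      Finset.prod_union hc.disjoint_primeFactors]
    ring

/-- The elementary inversion formula (Lemma on inversion of certain arithmetical functions):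
if `J(g) = ∑_{a|g} ∑_{b|L/g} μ(a) μ(b) ω2(a) ω1(b) K(bg/a)`, then for `L = A·B`,
`K(B) ∏_{p|L} (1 - ω1(p)ω2(p)) = ∑_{d|A} ∑_{e|B, (d,e)=1} ω1(d) ω2(e) J(Bd/e)`. -/
theorem inversion_formula (ω1 ω2 : ℕ → ℂ)
    (hω1 : ω1 1 = 1) (hω1mul : ∀ m n : ℕ, ω1 (m * n) = ω1 m * ω1 n)
    (hω2 : ω2 1 = 1) (hω2mul : ∀ m n : ℕ, ω2 (m * n) = ω2 m * ω2 n)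
    (L : ℕ) (hL : 0 < L) (K : ℕ → ℂ) (J : ℕ → ℂ)
    (hJ : ∀ g ∈ L.divisors, J g = ∑ a ∈ g.divisors, ∑ b ∈ (L / g).divisors,
      (moebius a : ℂ) * (moebius b : ℂ) * ω2 a * ω1 b * K (b * g / a))
    (A B : ℕ) (hAB : A * B = L) :
    K B * ∏ p ∈ L.primeFactors, (1 - ω1 p * ω2 p) =
      ∑ d ∈ A.divisors, ∑ e ∈ B.divisors,
        if Nat.gcd d e = 1 then ω1 d * ω2 e * J (B * d / e) else 0 := by
  rw [← inv_main ω1 ω2 hω1 hω1mul hω2 hω2mul L hL K A B hAB]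
  rw [invU_congr _ _ _ _ J]
  · unfold invU invV
    refine Finset.sum_congr rfl fun d _ => Finset.sum_congr rfl fun e _ => ?_
    rw [mul_comm B d]
    split_ifs <;> simp
  · intro g hg
    rw [hAB] at hg
    rw [hJ g (Nat.mem_divisors.2 ⟨hg, hL.ne'⟩), Finset.sum_comm]
    rfl
end

section
/- Let ω : ℕ → ℂ be a completely multiplicative function and let A, B be positive integers. Then ∑ μ(g)·μ(h)·μ(r)²·ω(r·g·h), where the sum is over all triples (g, h, r) of positive integers satisfying r·h ∣ B, r·g ∣ A, gcd(r, g·h) = 1 and gcd(g, h) = 1, equals ∏_{p ∣ A·B, p prime} (1 − ω(p)). -/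
open ArithmeticFunction

lemma kappa_aux_restrict (f : ℕ → ℂ) (K : Finset ℕ → ℂ) (V Q : Finset ℕ) :
    ∑ H ∈ V.powerset, (∏ p ∈ H, (if p ∈ Q then f p else 0)) * K H
      = ∑ H ∈ Q.powerset, if H ⊆ V then (∏ p ∈ H, f p) * K H else 0 := by
  rw [← Finset.sum_filter]
  have : (Q.powerset.filter (fun H => H ⊆ V)) = V.powerset.filter (fun H => H ⊆ Q) := by
    ext H; simp [and_comm]
  rw [this, Finset.sum_filter]
  refine Finset.sum_congr rfl fun H _ => ?_
  split_ifs with h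
  · congr 1
    exact Finset.prod_congr rfl fun p hp => if_pos (h hp)
  · obtain ⟨p, hp, hpQ⟩ := Finset.not_subset.mp h
    rw [Finset.prod_eq_zero hp (if_neg hpQ), zero_mul]

lemma kappa_aux_expand (f k : ℕ → ℂ) (V Q : Finset ℕ) :
    ∏ p ∈ V, ((if p ∈ Q then f p else 0) + k p)
      = ∑ H ∈ Q.powerset, if H ⊆ V then (∏ p ∈ H, f p) * ∏ p ∈ V \ H, k p else 0 := by
  rw [Finset.prod_add]
  exact kappa_aux_restrict f (fun H => ∏ p ∈ V \ H, k p) V Q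

lemma kappa_aux_sets (f : ℕ → ℂ) (P Q : Finset ℕ) :
    ∑ G ∈ P.powerset, ∑ H ∈ Q.powerset, ∑ R ∈ (P ∩ Q).powerset,
      (if Disjoint G H ∧ Disjoint R G ∧ Disjoint R H then
        (∏ p ∈ G, (-f p)) * (∏ p ∈ H, (-f p)) * (∏ p ∈ R, f p) else 0)
      = ∏ p ∈ P ∪ Q, (1 - f p) := by
  have key : ∏ p ∈ P ∪ Q, (1 - f p) = ∏ p ∈ P ∪ Q, ((if p ∈ P then -f p else 0) +
      ((if p ∈ Q then -f p else 0) + ((if p ∈ P ∩ Q then f p else 0) + 1))) := by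
    refine Finset.prod_congr rfl fun p hp => ?_
    rw [Finset.mem_union] at hp
    by_cases h1 : p ∈ P <;> by_cases h2 : p ∈ Q
    · simp [h1, h2]; ring
    · simp [h1, h2]; ring
    · simp [h1, h2]; ring
    · tauto
  have e3 : ∀ V : Finset ℕ, ∏ p ∈ V, ((if p ∈ P ∩ Q then f p else 0) + 1) = _ := fun V =>
    kappa_aux_expand f (fun _ => 1) V (P ∩ Q)
  have e2 : ∀ V : Finset ℕ, ∏ p ∈ V, ((if p ∈ Q then -f p else 0) +
      ((if p ∈ P ∩ Q then f p else 0) + 1)) = _ := fun V =>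
    kappa_aux_expand (fun p => -f p) (fun p => (if p ∈ P ∩ Q then f p else 0) + 1) V Q
  rw [key, kappa_aux_expand (fun p => -f p) (fun p => (if p ∈ Q then -f p else 0) +
      ((if p ∈ P ∩ Q then f p else 0) + 1))]
  simp only [e2, e3, Finset.prod_const_one]
  refine Finset.sum_congr rfl fun G hG => ?_
  rw [Finset.mem_powerset] at hG
  rw [if_pos (hG.trans Finset.subset_union_left), Finset.mul_sum]
  refine Finset.sum_congr rfl fun H hH => ?_
  rw [Finset.mem_powerset] at hH
  have e1 : H ⊆ (P ∪ Q) \ G ↔ Disjoint G H := by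
    rw [Finset.subset_sdiff, disjoint_comm]
    exact and_iff_right (hH.trans Finset.subset_union_right)
  by_cases h : Disjoint G H
  · rw [if_pos (e1.2 h), Finset.mul_sum, Finset.mul_sum]
    refine Finset.sum_congr rfl fun R hR => ?_
    rw [Finset.mem_powerset] at hR
    have e2 : R ⊆ ((P ∪ Q) \ G) \ H ↔ Disjoint R G ∧ Disjoint R H := by
      rw [Finset.subset_sdiff, Finset.subset_sdiff]
      have := hR.trans (Finset.inter_subset_left.trans (Finset.subset_union_left (s₂ := Q)))
      tauto
    by_cases h' : Disjoint R G ∧ Disjoint R H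
    · rw [if_pos ⟨h, h'⟩, if_pos (e2.2 h')]; ring
    · rw [if_neg (fun x => h' x.2), if_neg (fun x => h' (e2.1 x))]; ring
  · rw [if_neg (fun x => h (e1.1 x)), mul_zero]
    exact Finset.sum_eq_zero fun R _ => if_neg fun x => h x.1

lemma kappa_aux_div (N : ℕ) (hN : N ≠ 0) (F : ℕ → ℂ) (hF : ∀ d, ¬ Squarefree d → F d = 0) :
    ∑ d ∈ N.divisors, F d = ∑ S ∈ N.primeFactors.powerset, F (∏ p ∈ S, p) := by
  have h := Nat.sum_divisors_filter_squarefree hN (f := F)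
  rw [Finset.sum_filter_of_ne (fun d _ hd => by by_contra h'; exact hd (hF d h'))] at h
  rw [h]
  have : (UniqueFactorizationMonoid.normalizedFactors N).toFinset = N.primeFactors := by
    rw [Nat.factors_eq]; rfl
  rw [this]
  refine Finset.sum_congr rfl fun S _ => ?_
  rw [Finset.prod_val]; rfl

lemma kappa_aux_w (w : ℕ → ℂ) (hw1 : w 1 = 1) (hwmul : ∀ m n : ℕ, w (m * n) = w m * w n)
    (S : Finset ℕ) : w (∏ p ∈ S, p) = ∏ p ∈ S, w p := by
  induction S using Finset.induction_on with
  | empty => simpa using hw1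
  | insert a s ha ih => rw [Finset.prod_insert ha, Finset.prod_insert ha, hwmul, ih]

lemma kappa_aux_mu (S : Finset ℕ) (hS : ∀ p ∈ S, p.Prime) :
    ((moebius (∏ p ∈ S, p) : ℤ) : ℂ) = ∏ _p ∈ S, (-1 : ℂ) := by
  rw [isMultiplicative_moebius.map_prod_of_prime S hS, Int.cast_prod]
  refine Finset.prod_congr rfl fun p hp => ?_
  rw [moebius_apply_prime (hS p hp)]; simp

lemma kappa_aux_cop (S T : Finset ℕ) (hS : ∀ p ∈ S, p.Prime) (hT : ∀ p ∈ T, p.Prime) :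
    Nat.Coprime (∏ p ∈ S, p) (∏ p ∈ T, p) ↔ Disjoint S T := by
  rw [← Nat.disjoint_primeFactors (Finset.prod_ne_zero_iff.2 fun p hp => (hS p hp).ne_zero)
    (Finset.prod_ne_zero_iff.2 fun p hp => (hT p hp).ne_zero),
    Nat.primeFactors_prod hS, Nat.primeFactors_prod hT]

lemma kappa_aux_dvd (N : ℕ) (S : Finset ℕ) (h : S ⊆ N.primeFactors) : ∏ p ∈ S, p ∣ N :=
  (Finset.prod_dvd_prod_of_subset _ _ _ h).trans (Nat.prod_primeFactors_dvd N)

/-- `∑_{(g,h,r) : rh|B, rg|A, (r,gh)=1, (g,h)=1} μ(g) μ(h) μ(r)² w(rgh) = ∏_{p|AB} (1 - w(p))`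
for a completely multiplicative function `w`. -/
theorem kappa_evaluation (w : ℕ → ℂ)
    (hw1 : w 1 = 1) (hwmul : ∀ m n : ℕ, w (m * n) = w m * w n)
    (A B : ℕ) (hA : 0 < A) (hB : 0 < B) :
    (∑ g ∈ A.divisors, ∑ h ∈ B.divisors, ∑ r ∈ (Nat.gcd A B).divisors,
      if r * h ∣ B ∧ r * g ∣ A ∧ Nat.gcd r (g * h) = 1 ∧ Nat.gcd g h = 1 then
        (moebius g : ℂ) * (moebius h : ℂ) * (moebius r : ℂ) ^ 2 * w (r * g * h)
      else 0) =
      ∏ p ∈ (A * B).primeFactors, (1 - w p) := by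
  rw [Nat.primeFactors_mul hA.ne' hB.ne', ← kappa_aux_sets]
  rw [kappa_aux_div A hA.ne']
  swap
  · intro d hd
    simp [moebius_eq_zero_of_not_squarefree hd]
  refine Finset.sum_congr rfl fun G hG => ?_
  rw [kappa_aux_div B hB.ne']
  swap
  · intro d hd
    simp [moebius_eq_zero_of_not_squarefree hd]
  refine Finset.sum_congr rfl fun H hH => ?_
  rw [kappa_aux_div _ (Nat.gcd_pos_of_pos_left B hA).ne']
  swap
  · intro d hd
    simp [moebius_eq_zero_of_not_squarefree hd]
  rw [Nat.primeFactors_gcd hA.ne' hB.ne']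
  refine Finset.sum_congr rfl fun R hR => ?_
  rw [Finset.mem_powerset] at hG hH hR
  have hRA := hR.trans Finset.inter_subset_left
  have hRB := hR.trans Finset.inter_subset_right
  have pG : ∀ p ∈ G, p.Prime := fun p hp => Nat.prime_of_mem_primeFactors (hG hp)
  have pH : ∀ p ∈ H, p.Prime := fun p hp => Nat.prime_of_mem_primeFactors (hH hp)
  have pR : ∀ p ∈ R, p.Prime := fun p hp => Nat.prime_of_mem_primeFactors (hRA hp)
  have cGH := kappa_aux_cop G H pG pH
  have cRG := kappa_aux_cop R G pR pG
  have cRH := kappa_aux_cop R H pR pH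
  refine if_congr ?_ ?_ rfl
  · rw [← cGH, ← cRG, ← cRH, ← Nat.coprime_iff_gcd_eq_one, ← Nat.coprime_iff_gcd_eq_one,
      Nat.coprime_mul_iff_right]
    constructor
    · rintro ⟨_, _, h, h'⟩
      exact ⟨h', h⟩
    · rintro ⟨h', h⟩
      exact ⟨h.2.mul_dvd_of_dvd_of_dvd (kappa_aux_dvd _ _ hRB) (kappa_aux_dvd _ _ hH),
        h.1.mul_dvd_of_dvd_of_dvd (kappa_aux_dvd _ _ hRA) (kappa_aux_dvd _ _ hG), h, h'⟩
  · rw [kappa_aux_mu G pG, kappa_aux_mu H pH, kappa_aux_mu R pR, hwmul, hwmul,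
      kappa_aux_w w hw1 hwmul, kappa_aux_w w hw1 hwmul, kappa_aux_w w hw1 hwmul,
      ← Finset.prod_pow]
    have neg : ∀ S : Finset ℕ, ∏ p ∈ S, (-w p) = (∏ _p ∈ S, (-1 : ℂ)) * ∏ p ∈ S, w p := by
      intro S
      rw [← Finset.prod_mul_distrib]
      simp
    rw [neg, neg]
    have : ∏ _p ∈ R, (-1 : ℂ) ^ 2 = 1 := by simp
    rw [this]
    ring
end

section
/- Let χ1 and χ2 be primitive Dirichlet characters modulo q1 and q2, let t ∈ ℝ, let L be a positive integer, and set N = q1·q2·L. With G_B(R) and I(B1, B2) as defined below, and with A_{χ1,χ2} the multiplicative function defined below, for all positive divisors B1, B2 of L one has I(B1, B2) = I(1, 1) · A_{χ1,χ2}(B2/gcd(B1,B2)) · conj( A_{χ1,χ2}(B1/gcd(B1,B2)) ). -/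
open Complex

/-- `G_B(R) = ∑_{d | L/B, e | B, (d,e)=1, Bd = Re} χ1(d) χ2(e) (de)^{-(1/2+it)}`. -/
noncomputable def GFun {q1 q2 : ℕ} (χ1 : DirichletCharacter ℂ q1)
    (χ2 : DirichletCharacter ℂ q2) (t : ℝ) (L B R : ℕ) : ℂ :=
  ∑ d ∈ (L / B).divisors, ∑ e ∈ B.divisors,
    if Nat.gcd d e = 1 ∧ B * d = R * e then
      χ1 d * χ2 e * (((d * e : ℕ) : ℂ)) ^ (-(1 / 2 + I * t))
    else 0

/-- `I(B1,B2) = N ∑_{R|L} (φ((q2 R, q1 L/R))/(q2 R, q1 L/R)) G_{B1}(R) conj(G_{B2}(R))`,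
with `N = q1 q2 L`. -/
noncomputable def IFun {q1 q2 : ℕ} (χ1 : DirichletCharacter ℂ q1)
    (χ2 : DirichletCharacter ℂ q2) (t : ℝ) (L B1 B2 : ℕ) : ℂ :=
  ((q1 * q2 * L : ℕ) : ℂ) * ∑ R ∈ L.divisors,
    ((Nat.totient (Nat.gcd (q2 * R) (q1 * (L / R))) : ℂ) /
        ((Nat.gcd (q2 * R) (q1 * (L / R)) : ℕ) : ℂ)) *
      GFun χ1 χ2 t L B1 R * (starRingEnd ℂ) (GFun χ1 χ2 t L B2 R)

/-- The Hecke eigenvalue `λ(n) = ∑_{ab=n} χ1(a) conj(χ2)(b) (b/a)^{it}`. -/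
noncomputable def lamChiChi {q1 q2 : ℕ} (χ1 : DirichletCharacter ℂ q1)
    (χ2 : DirichletCharacter ℂ q2) (t : ℝ) (n : ℕ) : ℂ :=
  ∑ b ∈ n.divisors,
    χ1 ((n / b : ℕ)) * (starRingEnd ℂ) (χ2 b) * ((b : ℂ) / ((n / b : ℕ) : ℂ)) ^ (I * t)

/-- The prime-power values of the multiplicative function `A_{χ1,χ2}`:
`A(p^B) = (λ(p^B) - χ1 conj(χ2)(p) p⁻¹ λ(p^{B-2})) / (p^{B/2} (1 + χ0(p) p⁻¹))`,
with the convention `λ(p^{-1}) = 0` for `B = 1`. -/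
noncomputable def APow {q1 q2 : ℕ} (χ1 : DirichletCharacter ℂ q1)
    (χ2 : DirichletCharacter ℂ q2) (t : ℝ) (p : ℕ) (B : ℕ) : ℂ :=
  (lamChiChi χ1 χ2 t (p ^ B) -
      (χ1 p * (starRingEnd ℂ) (χ2 p)) * (p : ℂ)⁻¹ *
        (if B = 1 then 0 else lamChiChi χ1 χ2 t (p ^ (B - 2)))) /
    ((p : ℂ) ^ ((B : ℂ) / 2) * (1 + (1 : DirichletCharacter ℂ (q1 * q2)) p * (p : ℂ)⁻¹))

/-- The multiplicative function `A_{χ1,χ2}` determined by its prime-power values. -/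
noncomputable def AChi {q1 q2 : ℕ} (χ1 : DirichletCharacter ℂ q1)
    (χ2 : DirichletCharacter ℂ q2) (t : ℝ) (n : ℕ) : ℂ :=
  ∏ p ∈ n.primeFactors, APow χ1 χ2 t p (n.factorization p)


lemma geom_aux (x v : ℂ) (hv : v * v = x * v) (n : ℕ) :
    (1 - x) * ∑ j ∈ Finset.range n, v ^ (j + 1) + v * v ^ n = v := by
  induction n with
  | zero => simp
  | succ n ih =>
    rw [Finset.sum_range_succ]
    linear_combination ih + v ^ n * hv

lemma local_sum (x α β α' β' : ℂ) (hu : (α * α') * (α * α') = x * (α * α'))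
    (hv : (β * β') * (β * β') = x * (β * β')) (b m k : ℕ) :
    ∑ r ∈ Finset.range (b + m + k + 1),
      ((1 - x) + (if r = 0 then β * β' else 0) + (if r = b + m + k then α * α' else 0)) *
        (α ^ (r - b) * β ^ (b - r)) * (α' ^ (r - (b + m)) * β' ^ (b + m - r)) =
    (β * β') * β' ^ m + (α * α') * α ^ m +
      (1 - x) * ∑ i ∈ Finset.range (m + 1), α ^ i * β' ^ (m - i) := by
  have h1 : ∑ r ∈ Finset.range b, (α ^ (r - b) * β ^ (b - r)) *
      (α' ^ (r - (b + m)) * β' ^ (b + m - r)) =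
      β' ^ m * ∑ j ∈ Finset.range b, (β * β') ^ (j + 1) := by
    rw [← Finset.sum_range_reflect, Finset.mul_sum]
    refine Finset.sum_congr rfl fun j hj => ?_
    have hj := Finset.mem_range.1 hj
    rw [show b - 1 - j - b = 0 by omega, show b - (b - 1 - j) = j + 1 by omega,
      show b - 1 - j - (b + m) = 0 by omega, show b + m - (b - 1 - j) = m + (j + 1) by omega]
    ring
  have h2 : ∑ i ∈ Finset.range (m + 1), (α ^ (b + i - b) * β ^ (b - (b + i))) *
      (α' ^ (b + i - (b + m)) * β' ^ (b + m - (b + i))) =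
      ∑ i ∈ Finset.range (m + 1), α ^ i * β' ^ (m - i) := by
    refine Finset.sum_congr rfl fun j hj => ?_
    have hj := Finset.mem_range.1 hj
    rw [show b + j - b = j by omega, show b - (b + j) = 0 by omega,
      show b + j - (b + m) = 0 by omega, show b + m - (b + j) = m - j by omega]
    ring
  have h3 : ∑ i ∈ Finset.range k, (α ^ (b + (m + 1) + i - b) * β ^ (b - (b + (m + 1) + i))) *
      (α' ^ (b + (m + 1) + i - (b + m)) * β' ^ (b + m - (b + (m + 1) + i))) =
      α ^ m * ∑ j ∈ Finset.range k, (α * α') ^ (j + 1) := by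
    rw [Finset.mul_sum]
    refine Finset.sum_congr rfl fun j hj => ?_
    rw [show b + (m + 1) + j - b = m + (j + 1) by omega,
      show b - (b + (m + 1) + j) = 0 by omega,
      show b + (m + 1) + j - (b + m) = j + 1 by omega,
      show b + m - (b + (m + 1) + j) = 0 by omega]
    ring
  have hs : ∑ r ∈ Finset.range (b + m + k + 1), (α ^ (r - b) * β ^ (b - r)) *
      (α' ^ (r - (b + m)) * β' ^ (b + m - r)) =
      β' ^ m * ∑ j ∈ Finset.range b, (β * β') ^ (j + 1) +
      ∑ i ∈ Finset.range (m + 1), α ^ i * β' ^ (m - i) +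
      α ^ m * ∑ j ∈ Finset.range k, (α * α') ^ (j + 1) := by
    rw [show b + m + k + 1 = b + (m + 1) + k by ring, Finset.sum_range_add,
      Finset.sum_range_add, h1, h2, h3]
  have h0 : ∑ r ∈ Finset.range (b + m + k + 1), (if r = 0 then β * β' else 0) *
        ((α ^ (r - b) * β ^ (b - r)) * (α' ^ (r - (b + m)) * β' ^ (b + m - r))) =
        (β * β') * (β * β') ^ b * β' ^ m := by
    rw [Finset.sum_eq_single 0]
    · simp; ring
    · intro r _ hr; simp [hr]
    · simp
  have hl : ∑ r ∈ Finset.range (b + m + k + 1), (if r = b + m + k then α * α' else 0) *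
        ((α ^ (r - b) * β ^ (b - r)) * (α' ^ (r - (b + m)) * β' ^ (b + m - r))) =
        (α * α') * (α * α') ^ k * α ^ m := by
    rw [Finset.sum_eq_single (b + m + k)]
    · rw [show b + m + k - b = m + k by omega, show b - (b + m + k) = 0 by omega,
        show b + m + k - (b + m) = k by omega, show b + m - (b + m + k) = 0 by omega]
      simp; ring
    · intro r _ hr; simp [hr]
    · simp
  have key : ∀ r, ((1 - x) + (if r = 0 then β * β' else 0) +
      (if r = b + m + k then α * α' else 0)) *
        (α ^ (r - b) * β ^ (b - r)) * (α' ^ (r - (b + m)) * β' ^ (b + m - r)) =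
      (1 - x) * ((α ^ (r - b) * β ^ (b - r)) * (α' ^ (r - (b + m)) * β' ^ (b + m - r))) +
      (if r = 0 then β * β' else 0) *
        ((α ^ (r - b) * β ^ (b - r)) * (α' ^ (r - (b + m)) * β' ^ (b + m - r))) +
      (if r = b + m + k then α * α' else 0) *
        ((α ^ (r - b) * β ^ (b - r)) * (α' ^ (r - (b + m)) * β' ^ (b + m - r))) := by
    intro r; ring
  rw [Finset.sum_congr rfl fun r _ => key r, Finset.sum_add_distrib, Finset.sum_add_distrib,
    ← Finset.mul_sum, hs, h0, hl]
  linear_combination β' ^ m * geom_aux x _ hv b + α ^ m * geom_aux x _ hu k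

/-- Sums of products over primes factor. -/
lemma sum_divisors_prod (F : ℕ → ℕ → ℂ) (L : ℕ) (hL : 0 < L) :
    ∑ R ∈ L.divisors, ∏ p ∈ L.primeFactors, F p (R.factorization p) =
      ∏ p ∈ L.primeFactors, ∑ r ∈ Finset.range (L.factorization p + 1), F p r := by
  induction L using Nat.recOnPosPrimePosCoprime with
  | zero => simp at hL
  | one => simp
  | prime_pow p n hp hn =>
    rw [Nat.sum_divisors_prime_pow hp]
    simp [Nat.primeFactors_prime_pow hn.ne' hp, hp.factorization_self, Nat.factorization_pow]
  | coprime a b ha hb hab iha ihb =>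
    have ha0 : a ≠ 0 := by omega
    have hb0 : b ≠ 0 := by omega
    rw [hab.primeFactors_mul, Finset.prod_union hab.disjoint_primeFactors]
    have e1 : ∀ p ∈ a.primeFactors, (a * b).factorization p = a.factorization p := by
      intro p hp
      exact Nat.factorization_eq_of_coprime_left hab (by simpa using hp)
    have e2 : ∀ p ∈ b.primeFactors, (a * b).factorization p = b.factorization p := by
      intro p hp
      exact Nat.factorization_eq_of_coprime_right hab (by simpa using hp)
    rw [Finset.prod_congr rfl fun p hp => by rw [e1 p hp],
      Finset.prod_congr (s₁ := b.primeFactors) rfl fun p hp => by rw [e2 p hp],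
      ← iha (by omega), ← ihb (by omega), Finset.sum_mul_sum,
      ← Finset.sum_product']
    symm
    refine Finset.sum_nbij' (fun x => x.1 * x.2) (fun R => (Nat.gcd R a, Nat.gcd R b)) ?_ ?_ ?_ ?_ ?_
    · rintro ⟨d, e⟩ h
      simp only [Finset.mem_product, Nat.mem_divisors] at h ⊢
      exact ⟨Nat.mul_dvd_mul h.1.1 h.2.1, by positivity⟩
    · intro R h
      simp only [Finset.mem_product, Nat.mem_divisors] at h ⊢
      exact ⟨⟨Nat.gcd_dvd_right _ _, ha0⟩, ⟨Nat.gcd_dvd_right _ _, hb0⟩⟩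
    · rintro ⟨d, e⟩ h
      simp only [Finset.mem_product, Nat.mem_divisors] at h ⊢
      have h1 : Nat.Coprime e a := (hab.coprime_dvd_right h.2.1).symm
      have h2 : Nat.Coprime d b := hab.coprime_dvd_left h.1.1
      rw [Nat.Coprime.gcd_mul_right_cancel _ h1, Nat.Coprime.gcd_mul_left_cancel _ h2,
        Nat.gcd_eq_left h.1.1, Nat.gcd_eq_left h.2.1]
    · intro R h
      simp only [Nat.mem_divisors] at h ⊢
      rw [← hab.gcd_mul, Nat.gcd_eq_left h.1]
    · rintro ⟨d, e⟩ h
      simp only [Finset.mem_product, Nat.mem_divisors] at h ⊢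
      have hd0 : d ≠ 0 := ne_zero_of_dvd_ne_zero ha0 h.1.1
      have he0 : e ≠ 0 := ne_zero_of_dvd_ne_zero hb0 h.2.1
      rw [Finset.prod_union hab.disjoint_primeFactors]
      congr 1
      · refine Finset.prod_congr rfl fun p hp => ?_
        have : e.factorization p = 0 := by
          apply Nat.factorization_eq_zero_of_not_dvd
          intro hpe
          exact Finset.disjoint_left.1 hab.disjoint_primeFactors hp
            (Nat.mem_primeFactors.2 ⟨Nat.prime_of_mem_primeFactors hp, hpe.trans h.2.1, hb0⟩)
        rw [Nat.factorization_mul hd0 he0, Finsupp.add_apply, this, add_zero]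
      · refine Finset.prod_congr rfl fun p hp => ?_
        have : d.factorization p = 0 := by
          apply Nat.factorization_eq_zero_of_not_dvd
          intro hpe
          exact Finset.disjoint_left.1 hab.disjoint_primeFactors
            (Nat.mem_primeFactors.2 ⟨Nat.prime_of_mem_primeFactors hp, hpe.trans h.1.1, ha0⟩) hp
        rw [Nat.factorization_mul hd0 he0, Finsupp.add_apply, this, zero_add]

lemma mh_prod (f : ℕ →* ℂ) (n L : ℕ) (hL : L ≠ 0) (h : n ∣ L) :
    f n = ∏ p ∈ L.primeFactors, f p ^ n.factorization p := by
  have hn : n ≠ 0 := ne_zero_of_dvd_ne_zero hL h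
  conv_lhs => rw [← Nat.prod_factorization_pow_eq_self hn]
  rw [Finsupp.prod, map_prod]
  rw [Nat.support_factorization]
  simp_rw [map_pow]
  refine Finset.prod_subset (Nat.primeFactors_mono h hL) fun p _ hp => ?_
  rw [← Nat.support_factorization, Finsupp.notMem_support_iff] at hp
  simp [hp]

/-- The completely multiplicative function `n ↦ χ(n) n^{-(1/2+it)}`. -/
noncomputable def fHom {q : ℕ} (χ : DirichletCharacter ℂ q) (t : ℝ) : ℕ →* ℂ where
  toFun n := χ n * (n : ℂ) ^ (-(1 / 2 + I * t))
  map_one' := by simp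
  map_mul' m n := by
    push_cast
    rw [natCast_mul_natCast_cpow, map_mul]
    ring

lemma fHom_apply {q : ℕ} (χ : DirichletCharacter ℂ q) (t : ℝ) (n : ℕ) :
    fHom χ t n = χ n * (n : ℂ) ^ (-(1 / 2 + I * t)) := rfl

lemma GFun_eq {q1 q2 : ℕ} (χ1 : DirichletCharacter ℂ q1) (χ2 : DirichletCharacter ℂ q2) (t : ℝ)
    (L B R : ℕ) (hL : 0 < L) (hB : B ∣ L) (hR : R ∣ L) :
    GFun χ1 χ2 t L B R = fHom χ1 t (R / Nat.gcd R B) * fHom χ2 t (B / Nat.gcd R B) := by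
  have hB0 : 0 < B := Nat.pos_of_dvd_of_pos hB hL
  have hR0 : 0 < R := Nat.pos_of_dvd_of_pos hR hL
  have hg : 0 < Nat.gcd R B := Nat.gcd_pos_of_pos_left _ hR0
  obtain ⟨g, R', B', hg0, hco, hRe, hBe⟩ : ∃ g R' B', 0 < g ∧ Nat.Coprime R' B' ∧
      R = R' * g ∧ B = B' * g := by
    obtain ⟨R', B', h1, h2, h3⟩ := Nat.exists_coprime R B
    exact ⟨_, R', B', hg, h1, h2, h3⟩
  have hgcd : Nat.gcd R B = g := by
    rw [hRe, hBe, Nat.gcd_mul_right, hco.gcd_eq_one, one_mul]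
  rw [hgcd, hRe, hBe, Nat.mul_div_cancel _ hg0, Nat.mul_div_cancel _ hg0]
  rw [← hRe, ← hBe]
  have hR'0 : 0 < R' := Nat.pos_of_ne_zero (by rintro rfl; simp at hRe; omega)
  have hB'0 : 0 < B' := Nat.pos_of_ne_zero (by rintro rfl; simp at hBe; omega)
  have hdvd : R' ∣ L / B := by
    refine (Nat.dvd_div_iff_mul_dvd hB).2 ?_
    have : Nat.lcm R B ∣ L := Nat.lcm_dvd hR hB
    have h2 : Nat.lcm R B = B * R' := by
      have := Nat.gcd_mul_lcm R B
      rw [hgcd] at this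
      apply Nat.eq_of_mul_eq_mul_left hg0
      rw [this, hRe]; ring
    rwa [← h2]
  have huniq : ∀ d e : ℕ, Nat.gcd d e = 1 ∧ B * d = R * e → d = R' ∧ e = B' := by
    rintro d e ⟨h1, h2⟩
    have h3 : B' * d = R' * e := by
      apply Nat.eq_of_mul_eq_mul_left hg0
      rw [hRe, hBe] at h2
      linarith
    have h4 : d = R' := Nat.dvd_antisymm
      (Nat.Coprime.dvd_of_dvd_mul_right h1 (h3 ▸ Dvd.intro_left _ rfl))
      (Nat.Coprime.dvd_of_dvd_mul_left hco (h3 ▸ Dvd.intro _ rfl))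
    refine ⟨h4, ?_⟩
    subst h4
    apply Nat.eq_of_mul_eq_mul_left hR'0
    rw [← h3]; ring
  have hLB : L / B ≠ 0 := (Nat.div_pos (Nat.le_of_dvd hL hB) hB0).ne'
  unfold GFun
  rw [Finset.sum_eq_single R', Finset.sum_eq_single B', if_pos]
  · rw [fHom_apply, fHom_apply]
    push_cast
    rw [natCast_mul_natCast_cpow]
    ring
  · exact ⟨hco, by rw [hRe, hBe]; ring⟩
  · intro e _ he
    exact if_neg fun h => he (huniq _ _ h).2
  · intro h
    exact absurd (Nat.mem_divisors.2 ⟨hBe ▸ Dvd.intro _ rfl, hB0.ne'⟩) h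
  · intro d _ hd
    exact Finset.sum_eq_zero fun e _ => if_neg fun h => hd (huniq _ _ h).1
  · intro h
    exact absurd (Nat.mem_divisors.2 ⟨hdvd, hLB⟩) h

lemma fact_div_gcd (a b p : ℕ) (ha : a ≠ 0) (hb : b ≠ 0) :
    (a / Nat.gcd a b).factorization p = a.factorization p - b.factorization p := by
  rw [Nat.factorization_div (Nat.gcd_dvd_left _ _), Nat.factorization_gcd ha hb]
  simp only [Finsupp.coe_tsub, Pi.sub_apply, Finsupp.inf_apply]
  rcases le_total (a.factorization p) (b.factorization p) with h | h <;> simp [h]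

lemma GFun_prod {q1 q2 : ℕ} (χ1 : DirichletCharacter ℂ q1) (χ2 : DirichletCharacter ℂ q2) (t : ℝ)
    (L B R : ℕ) (hL : 0 < L) (hB : B ∣ L) (hR : R ∣ L) :
    GFun χ1 χ2 t L B R = ∏ p ∈ L.primeFactors,
      (fHom χ1 t p ^ (R.factorization p - B.factorization p) *
        fHom χ2 t p ^ (B.factorization p - R.factorization p)) := by
  have hB0 : B ≠ 0 := (Nat.pos_of_dvd_of_pos hB hL).ne'
  have hR0 : R ≠ 0 := (Nat.pos_of_dvd_of_pos hR hL).ne'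
  rw [GFun_eq χ1 χ2 t L B R hL hB hR,
    mh_prod _ _ L hL.ne' ((Nat.div_dvd_of_dvd (Nat.gcd_dvd_left R B)).trans hR),
    mh_prod _ _ L hL.ne' ((Nat.div_dvd_of_dvd (Nat.gcd_dvd_right R B)).trans hB),
    ← Finset.prod_mul_distrib]
  refine Finset.prod_congr rfl fun p _ => ?_
  rw [fact_div_gcd R B p hR0 hB0, Nat.gcd_comm, fact_div_gcd B R p hB0 hR0]

/-- Squared absolute value of a Dirichlet character at a prime. -/
lemma chi_conj {q : ℕ} (χ : DirichletCharacter ℂ q) (p : ℕ) (hp : p.Prime) :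
    χ p * (starRingEnd ℂ) (χ p) = if p ∣ q then 0 else 1 := by
  split_ifs with h
  · rw [χ.map_nonunit, zero_mul]
    rw [ZMod.isUnit_iff_coprime, hp.coprime_iff_not_dvd]
    exact fun h' => h' h
  · have : IsUnit (p : ZMod q) := by
      rwa [ZMod.isUnit_iff_coprime, hp.coprime_iff_not_dvd]
    obtain ⟨u, hu⟩ := this
    rw [← hu, Complex.mul_conj, Complex.normSq_eq_norm_sq, χ.unit_norm_eq_one]
    simp

lemma half_cpow (p : ℕ) (hp : p ≠ 0) : ((p : ℂ) ^ (-(1 / 2 : ℂ))) * ((p : ℂ) ^ (-(1 / 2 : ℂ))) =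
    (p : ℂ)⁻¹ := by
  have : (p : ℂ) ≠ 0 := by exact_mod_cast hp
  rw [← cpow_add _ _ this, ← cpow_neg_one]
  norm_num

lemma conj_natCast_cpow (n : ℕ) (s : ℂ) : (starRingEnd ℂ) ((n : ℂ) ^ s) =
    (n : ℂ) ^ ((starRingEnd ℂ) s) := by
  rw [cpow_conj _ _ (by rw [natCast_arg]; exact Real.pi_pos.ne), map_natCast]

lemma fHom_split {q : ℕ} (χ : DirichletCharacter ℂ q) (t : ℝ) (p : ℕ) (hp : p ≠ 0) :
    fHom χ t p = χ p * (p : ℂ) ^ (-(1 / 2 : ℂ)) * ((p : ℂ) ^ (I * t))⁻¹ := by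
  have : (p : ℂ) ≠ 0 := by exact_mod_cast hp
  rw [fHom_apply, neg_add, cpow_add _ _ this, cpow_neg _ (I * t), mul_assoc]

lemma fHom_conj {q : ℕ} (χ : DirichletCharacter ℂ q) (t : ℝ) (p : ℕ) (hp : p ≠ 0) :
    (starRingEnd ℂ) (fHom χ t p) =
      (starRingEnd ℂ) (χ p) * (p : ℂ) ^ (-(1 / 2 : ℂ)) * ((p : ℂ) ^ (I * t)) := by
  have : (p : ℂ) ≠ 0 := by exact_mod_cast hp
  rw [fHom_apply, map_mul, conj_natCast_cpow, mul_assoc, ← cpow_add _ _ this]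
  simp [map_ofNat, add_comm]

lemma fHom_norm {q : ℕ} (χ : DirichletCharacter ℂ q) (t : ℝ) (p : ℕ) (hp : p.Prime) :
    fHom χ t p * (starRingEnd ℂ) (fHom χ t p) = if p ∣ q then 0 else (p : ℂ)⁻¹ := by
  have h0 : (p : ℂ) ≠ 0 := by exact_mod_cast hp.ne_zero
  have h1 : (p : ℂ) ^ (I * t) ≠ 0 := by simp [cpow_eq_zero_iff, h0]
  have h2 := chi_conj χ p hp
  have h3 := half_cpow p hp.ne_zero
  rw [fHom_conj _ _ _ hp.ne_zero, fHom_split _ _ _ hp.ne_zero]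
  calc _ = (χ p * (starRingEnd ℂ) (χ p)) *
        ((p : ℂ) ^ (-(1 / 2 : ℂ)) * (p : ℂ) ^ (-(1 / 2 : ℂ))) *
          (((p : ℂ) ^ (I * t))⁻¹ * (p : ℂ) ^ (I * t)) := by ring
    _ = _ := by rw [h2, h3, inv_mul_cancel₀ h1]; split_ifs <;> simp

lemma fHom_norm_sq {q : ℕ} (χ : DirichletCharacter ℂ q) (t : ℝ) (p : ℕ) (hp : p.Prime) :
    (fHom χ t p * (starRingEnd ℂ) (fHom χ t p)) * (fHom χ t p * (starRingEnd ℂ) (fHom χ t p)) =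
      (p : ℂ)⁻¹ * (fHom χ t p * (starRingEnd ℂ) (fHom χ t p)) := by
  rw [fHom_norm χ t p hp]; split_ifs <;> simp

lemma fHom_norm_mul {q : ℕ} (χ : DirichletCharacter ℂ q) (t : ℝ) (p : ℕ) (hp : p.Prime) :
    (fHom χ t p * (starRingEnd ℂ) (fHom χ t p)) * fHom χ t p = (p : ℂ)⁻¹ * fHom χ t p := by
  have h := fHom_norm χ t p hp
  split_ifs at h with hq
  · rcases mul_eq_zero.1 h with h | h
    · simp [h]
    · simp [(map_eq_zero _).1 h]
  · rw [h]

lemma lam_pow {q1 q2 : ℕ} (χ1 : DirichletCharacter ℂ q1) (χ2 : DirichletCharacter ℂ q2) (t : ℝ)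
    (p m : ℕ) (hp : p.Prime) :
    lamChiChi χ1 χ2 t (p ^ m) * ((p : ℂ) ^ (-(1 / 2 : ℂ))) ^ m =
      ∑ i ∈ Finset.range (m + 1), fHom χ1 t p ^ i * (starRingEnd ℂ) (fHom χ2 t p) ^ (m - i) := by
  have h0 : (p : ℂ) ≠ 0 := by exact_mod_cast hp.ne_zero
  have h1 : (p : ℂ) ^ (I * t) ≠ 0 := by simp [cpow_eq_zero_iff, h0]
  unfold lamChiChi
  rw [Nat.sum_divisors_prime_pow hp, ← Finset.sum_range_reflect, Finset.sum_mul]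
  refine Finset.sum_congr rfl fun i hi => ?_
  have hi : i ≤ m := by have := Finset.mem_range.1 hi; omega
  obtain ⟨k, rfl⟩ := Nat.exists_eq_add_of_le hi
  rw [show i + k + 1 - 1 - i = k by omega, show i + k - i = k by omega,
    pow_add p, Nat.mul_div_cancel _ (pow_pos hp.pos _), fHom_conj _ _ _ hp.ne_zero,
    fHom_split _ _ _ hp.ne_zero]
  have hc : (((p ^ k : ℕ) : ℂ) / ((p ^ i : ℕ) : ℂ)) ^ (I * t) =
      ((p : ℂ) ^ (I * t)) ^ k * (((p : ℂ) ^ (I * t))⁻¹) ^ i := by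
    have e : ∀ j : ℕ, ((p ^ j : ℕ) : ℂ) ^ (I * t) = ((p : ℂ) ^ (I * t)) ^ j := by
      intro j
      induction j with
      | zero => simp
      | succ j ih => rw [pow_succ, Nat.cast_mul, natCast_mul_natCast_cpow, ih, pow_succ]
    have hne : ((p ^ i : ℕ) : ℂ) ≠ 0 := by exact_mod_cast (pow_pos hp.pos i).ne'
    have hm : (((p ^ k : ℕ) : ℂ) / ((p ^ i : ℕ) : ℂ)) ^ (I * t) * ((p ^ i : ℕ) : ℂ) ^ (I * t) =
        ((p ^ k : ℕ) : ℂ) ^ (I * t) := by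
      have := Complex.mul_cpow_ofReal_nonneg (a := ((p ^ k : ℕ) : ℝ) / ((p ^ i : ℕ) : ℝ))
        (b := ((p ^ i : ℕ) : ℝ)) (by positivity) (by positivity) (I * t)
      rw [ofReal_div, ofReal_natCast, ofReal_natCast, div_mul_cancel₀ _ hne] at this
      exact this.symm
    rw [e, e] at hm
    rw [inv_pow, ← div_eq_mul_inv, eq_div_iff (pow_ne_zero _ h1)]
    exact hm
  rw [hc, Nat.cast_pow, Nat.cast_pow, map_pow, map_pow, map_pow]
  ring

lemma chi0_apply (q p : ℕ) (hp : p.Prime) :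
    (1 : DirichletCharacter ℂ q) p = if p ∣ q then 0 else 1 := by
  split_ifs with h
  · apply MulChar.map_nonunit
    rw [ZMod.isUnit_iff_coprime, hp.coprime_iff_not_dvd]
    exact fun h' => h' h
  · apply MulChar.one_apply
    rwa [ZMod.isUnit_iff_coprime, hp.coprime_iff_not_dvd]

lemma one_add_ne (q p : ℕ) (hp : p.Prime) :
    (1 + (1 : DirichletCharacter ℂ q) p * (p : ℂ)⁻¹) ≠ 0 := by
  rw [chi0_apply q p hp]
  split_ifs
  · simp
  · have : (1 : ℂ) + 1 * (p : ℂ)⁻¹ = ((1 + (p : ℝ)⁻¹ : ℝ) : ℂ) := by push_cast; ring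
    rw [this]
    have : (0 : ℝ) < 1 + (p : ℝ)⁻¹ := by positivity
    exact_mod_cast this.ne'

lemma APow_mul {q1 q2 : ℕ} (χ1 : DirichletCharacter ℂ q1) (χ2 : DirichletCharacter ℂ q2) (t : ℝ)
    (p m : ℕ) (hp : p.Prime) (hm : m ≠ 0) :
    APow χ1 χ2 t p m * (1 + (1 : DirichletCharacter ℂ (q1 * q2)) p * (p : ℂ)⁻¹) =
      (1 - (p : ℂ)⁻¹) * ∑ i ∈ Finset.range (m + 1),
          fHom χ1 t p ^ i * (starRingEnd ℂ) (fHom χ2 t p) ^ (m - i) +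
        (p : ℂ)⁻¹ * (fHom χ1 t p ^ m + (starRingEnd ℂ) (fHom χ2 t p) ^ m) := by
  have h0 : (p : ℂ) ≠ 0 := by exact_mod_cast hp.ne_zero
  have h1 : (p : ℂ) ^ (I * t) ≠ 0 := by simp [cpow_eq_zero_iff, h0]
  have hD := one_add_ne (q1 * q2) p hp
  have hz : ((p : ℂ) ^ ((m : ℂ) / 2))⁻¹ = ((p : ℂ) ^ (-(1 / 2 : ℂ))) ^ m := by
    rw [← cpow_neg, ← cpow_nat_mul]
    congr 1
    ring
  have hA : APow χ1 χ2 t p m * (1 + (1 : DirichletCharacter ℂ (q1 * q2)) p * (p : ℂ)⁻¹) =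
      (lamChiChi χ1 χ2 t (p ^ m) - (χ1 p * (starRingEnd ℂ) (χ2 p)) * (p : ℂ)⁻¹ *
        (if m = 1 then 0 else lamChiChi χ1 χ2 t (p ^ (m - 2)))) *
        ((p : ℂ) ^ (-(1 / 2 : ℂ))) ^ m := by
    unfold APow
    rw [← hz, div_eq_mul_inv, mul_inv, ← mul_assoc, inv_mul_cancel_right₀ hD]
  rw [hA, sub_mul, lam_pow χ1 χ2 t p m hp]
  obtain _ | _ | n := m
  · exact absurd rfl hm
  · simp [Finset.sum_range_succ]
    ring
  · have hl := lam_pow χ1 χ2 t p n hp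
    have hab : fHom χ1 t p * (starRingEnd ℂ) (fHom χ2 t p) =
        (χ1 p * (starRingEnd ℂ) (χ2 p)) *
          (((p : ℂ) ^ (-(1 / 2 : ℂ))) * ((p : ℂ) ^ (-(1 / 2 : ℂ)))) := by
      rw [fHom_conj _ _ _ hp.ne_zero, fHom_split _ _ _ hp.ne_zero]
      field_simp
    have hh : ∑ i ∈ Finset.range (n + 2 + 1),
          fHom χ1 t p ^ i * (starRingEnd ℂ) (fHom χ2 t p) ^ (n + 2 - i) =
        fHom χ1 t p ^ (n + 2) + (starRingEnd ℂ) (fHom χ2 t p) ^ (n + 2) +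
        fHom χ1 t p * (starRingEnd ℂ) (fHom χ2 t p) * ∑ i ∈ Finset.range (n + 1),
          fHom χ1 t p ^ i * (starRingEnd ℂ) (fHom χ2 t p) ^ (n - i) := by
      rw [Finset.sum_range_succ, Finset.sum_range_succ', Finset.mul_sum]
      have : ∀ i ∈ Finset.range (n + 1),
          fHom χ1 t p ^ (i + 1) * (starRingEnd ℂ) (fHom χ2 t p) ^ (n + 2 - (i + 1)) =
          fHom χ1 t p * (starRingEnd ℂ) (fHom χ2 t p) *
          (fHom χ1 t p ^ i * (starRingEnd ℂ) (fHom χ2 t p) ^ (n - i)) := by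
        intro i hi
        have hi := Finset.mem_range.1 hi
        rw [show n + 2 - (i + 1) = (n - i) + 1 by omega]
        ring
      rw [Finset.sum_congr rfl this]
      simp
      ring
    rw [if_neg (by omega), show n + 1 + 1 - 2 = n by omega, show n + 1 + 1 = n + 2 by ring, hh]
    rw [← hl, hab]
    ring

/-- Local value of `A`, with value `1` at exponent `0`. -/
noncomputable def ALoc {q1 q2 : ℕ} (χ1 : DirichletCharacter ℂ q1)
    (χ2 : DirichletCharacter ℂ q2) (t : ℝ) (p m : ℕ) : ℂ :=
  if m = 0 then 1 else APow χ1 χ2 t p m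

lemma AChi_prod {q1 q2 : ℕ} (χ1 : DirichletCharacter ℂ q1) (χ2 : DirichletCharacter ℂ q2) (t : ℝ)
    (n L : ℕ) (hL : L ≠ 0) (h : n ∣ L) :
    AChi χ1 χ2 t n = ∏ p ∈ L.primeFactors, ALoc χ1 χ2 t p (n.factorization p) := by
  unfold AChi
  have e : ∀ p ∈ n.primeFactors, APow χ1 χ2 t p (n.factorization p) =
      ALoc χ1 χ2 t p (n.factorization p) := by
    intro p hp
    rw [← Nat.support_factorization, Finsupp.mem_support_iff] at hp
    simp [ALoc, hp]
  rw [Finset.prod_congr rfl e]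
  refine Finset.prod_subset (Nat.primeFactors_mono h hL) fun p _ hp => ?_
  rw [← Nat.support_factorization, Finsupp.notMem_support_iff] at hp
  simp [hp, ALoc]

/-- The local factor of the weight `φ(g)/g`. -/
noncomputable def wLoc (q1 q2 p l r : ℕ) : ℂ :=
  (1 - (p : ℂ)⁻¹) + (if r = 0 then (if p ∣ q2 then 0 else (p : ℂ)⁻¹) else 0) +
    (if r = l then (if p ∣ q1 then 0 else (p : ℂ)⁻¹) else 0)

/-- The local inner product. -/
noncomputable def sLoc {q1 q2 : ℕ} (χ1 : DirichletCharacter ℂ q1)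
    (χ2 : DirichletCharacter ℂ q2) (t : ℝ) (p l b1 b2 : ℕ) : ℂ :=
  ∑ r ∈ Finset.range (l + 1), wLoc q1 q2 p l r *
    (fHom χ1 t p ^ (r - b1) * fHom χ2 t p ^ (b1 - r)) *
    ((starRingEnd ℂ) (fHom χ1 t p) ^ (r - b2) * (starRingEnd ℂ) (fHom χ2 t p) ^ (b2 - r))

lemma sLoc_eq {q1 q2 : ℕ} (χ1 : DirichletCharacter ℂ q1)
    (χ2 : DirichletCharacter ℂ q2) (t : ℝ) (p l b m : ℕ) (hp : p.Prime) (h : b + m ≤ l) :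
    sLoc χ1 χ2 t p l b (b + m) =
    (fHom χ2 t p * (starRingEnd ℂ) (fHom χ2 t p)) * (starRingEnd ℂ) (fHom χ2 t p) ^ m +
      (fHom χ1 t p * (starRingEnd ℂ) (fHom χ1 t p)) * fHom χ1 t p ^ m +
      (1 - (p : ℂ)⁻¹) * ∑ i ∈ Finset.range (m + 1),
          fHom χ1 t p ^ i * (starRingEnd ℂ) (fHom χ2 t p) ^ (m - i) := by
  obtain ⟨k, rfl⟩ := Nat.exists_eq_add_of_le h
  rw [← local_sum _ _ _ _ _ (fHom_norm_sq χ1 t p hp) (fHom_norm_sq χ2 t p hp) b m k]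
  unfold sLoc wLoc
  rw [fHom_norm χ1 t p hp, fHom_norm χ2 t p hp]

lemma sLoc_le {q1 q2 : ℕ} (χ1 : DirichletCharacter ℂ q1)
    (χ2 : DirichletCharacter ℂ q2) (t : ℝ) (p l b m : ℕ) (hp : p.Prime) (h : b + m ≤ l) :
    sLoc χ1 χ2 t p l b (b + m) = sLoc χ1 χ2 t p l 0 0 * ALoc χ1 χ2 t p m := by
  have h00 := sLoc_eq χ1 χ2 t p l 0 0 hp (Nat.zero_le _)
  rw [Nat.add_zero] at h00
  rw [h00, sLoc_eq χ1 χ2 t p l b m hp h]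
  unfold ALoc
  split_ifs with hm
  · subst hm; simp
  have hA := APow_mul χ1 χ2 t p m hp hm
  have hx1 : (fHom χ1 t p * (starRingEnd ℂ) (fHom χ1 t p)) * fHom χ1 t p ^ m =
      (p : ℂ)⁻¹ * fHom χ1 t p ^ m := by
    obtain ⟨n, rfl⟩ := Nat.exists_eq_succ_of_ne_zero hm
    rw [Nat.succ_eq_add_one, pow_succ]
    linear_combination fHom χ1 t p ^ n * fHom_norm_mul χ1 t p hp
  have hx2 : (fHom χ2 t p * (starRingEnd ℂ) (fHom χ2 t p)) * (starRingEnd ℂ) (fHom χ2 t p) ^ m =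
      (p : ℂ)⁻¹ * (starRingEnd ℂ) (fHom χ2 t p) ^ m := by
    obtain ⟨n, rfl⟩ := Nat.exists_eq_succ_of_ne_zero hm
    rw [Nat.succ_eq_add_one, pow_succ]
    have := congrArg (starRingEnd ℂ) (fHom_norm_mul χ2 t p hp)
    simp only [map_mul, map_inv₀, map_natCast, starRingEnd_self_apply] at this
    linear_combination (starRingEnd ℂ) (fHom χ2 t p) ^ n * this
  rw [hx1, hx2]
  have hT : (p : ℂ)⁻¹ * (starRingEnd ℂ) (fHom χ2 t p) ^ m + (p : ℂ)⁻¹ * fHom χ1 t p ^ m +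
      (1 - (p : ℂ)⁻¹) * ∑ i ∈ Finset.range (m + 1),
          fHom χ1 t p ^ i * (starRingEnd ℂ) (fHom χ2 t p) ^ (m - i) =
      APow χ1 χ2 t p m * (1 + (1 : DirichletCharacter ℂ (q1 * q2)) p * (p : ℂ)⁻¹) := by
    rw [hA]; ring
  rw [hT]
  have n1 := fHom_norm χ1 t p hp
  have n2 := fHom_norm χ2 t p hp
  rw [n1, n2, chi0_apply _ p hp]
  simp only [hp.dvd_mul]
  by_cases c1 : p ∣ q1 <;> by_cases c2 : p ∣ q2
  · -- both vanish
    rw [if_pos c1] at n1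
    rw [if_pos c2] at n2
    have a1 : fHom χ1 t p = 0 := by simpa using n1
    have a2 : fHom χ2 t p = 0 := by simpa using n2
    have hz : APow χ1 χ2 t p m = 0 := by
      have := hA
      rw [a1, a2, chi0_apply _ p hp, if_pos (hp.dvd_mul.2 (Or.inl c1))] at this
      rw [Finset.sum_eq_zero] at this
      · simpa [hm] using this
      · intro i hi
        rcases Nat.eq_zero_or_pos i with h | h
        · subst h; simp [hm]
        · simp [h.ne']
    rw [hz]; simp
  all_goals simp [c1, c2]
  all_goals ring

lemma sLoc_conj {q1 q2 : ℕ} (χ1 : DirichletCharacter ℂ q1)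
    (χ2 : DirichletCharacter ℂ q2) (t : ℝ) (p l b1 b2 : ℕ) :
    sLoc χ1 χ2 t p l b1 b2 = (starRingEnd ℂ) (sLoc χ1 χ2 t p l b2 b1) := by
  unfold sLoc
  rw [map_sum]
  refine Finset.sum_congr rfl fun r _ => ?_
  have hw : (starRingEnd ℂ) (wLoc q1 q2 p l r) = wLoc q1 q2 p l r := by
    unfold wLoc
    split_ifs <;> simp
  simp only [map_mul, map_pow, starRingEnd_self_apply, hw]
  ring

lemma sLoc_main {q1 q2 : ℕ} (χ1 : DirichletCharacter ℂ q1)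
    (χ2 : DirichletCharacter ℂ q2) (t : ℝ) (p l b1 b2 : ℕ) (hp : p.Prime)
    (h1 : b1 ≤ l) (h2 : b2 ≤ l) :
    sLoc χ1 χ2 t p l b1 b2 = sLoc χ1 χ2 t p l 0 0 * ALoc χ1 χ2 t p (b2 - b1) *
      (starRingEnd ℂ) (ALoc χ1 χ2 t p (b1 - b2)) := by
  rcases le_total b1 b2 with h | h
  · obtain ⟨m, rfl⟩ := Nat.exists_eq_add_of_le h
    rw [sLoc_le χ1 χ2 t p l b1 m hp h2]
    simp [ALoc]
  · obtain ⟨m, rfl⟩ := Nat.exists_eq_add_of_le h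
    rw [sLoc_conj, sLoc_le χ1 χ2 t p l b2 m hp h1, map_mul, ← sLoc_conj]
    simp [ALoc]

lemma weight_prod (q1 q2 L R : ℕ) (hq1 : q1 ≠ 0) (hq2 : q2 ≠ 0) (hL : 0 < L) (hR : R ∣ L) :
    ((Nat.totient (Nat.gcd (q2 * R) (q1 * (L / R))) : ℂ) /
        ((Nat.gcd (q2 * R) (q1 * (L / R)) : ℕ) : ℂ)) =
    (∏ p ∈ (q1 * q2 * L).primeFactors \ L.primeFactors,
      if p ∣ q2 ∧ p ∣ q1 then (1 - (p : ℂ)⁻¹) else 1) *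
    ∏ p ∈ L.primeFactors, wLoc q1 q2 p (L.factorization p) (R.factorization p) := by
  have hR0 : R ≠ 0 := (Nat.pos_of_dvd_of_pos hR hL).ne'
  have hLR0 : L / R ≠ 0 := (Nat.div_pos (Nat.le_of_dvd hL hR) (Nat.pos_of_ne_zero hR0)).ne'
  set g := Nat.gcd (q2 * R) (q1 * (L / R)) with hg
  have hg0 : g ≠ 0 := Nat.gcd_ne_zero_left (Nat.mul_ne_zero hq2 hR0)
  have hN0 : q1 * q2 * L ≠ 0 := Nat.mul_ne_zero (Nat.mul_ne_zero hq1 hq2) hL.ne'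
  have hgN : g ∣ q1 * q2 * L :=
    (Nat.gcd_dvd_left _ _).trans ((Nat.mul_dvd_mul (Dvd.intro_left q1 rfl) hR))
  have hphi : (g.totient : ℂ) / (g : ℂ) = ∏ p ∈ g.primeFactors, (1 - (p : ℂ)⁻¹) := by
    have h := Nat.totient_eq_mul_prod_factors g
    have h' : (g.totient : ℂ) = (g : ℂ) * ∏ p ∈ g.primeFactors, (1 - (p : ℂ)⁻¹) := by
      have h2 := congrArg (fun x : ℚ => (x : ℂ)) h
      push_cast at h2
      exact h2
    rw [h', mul_div_cancel_left₀]
    exact_mod_cast hg0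
  have hfil : g.primeFactors = (q1 * q2 * L).primeFactors.filter (fun p => p ∣ g) := by
    ext p
    simp only [Nat.mem_primeFactors, Finset.mem_filter]
    exact ⟨fun h => ⟨⟨h.1, h.2.1.trans hgN, hN0⟩, h.2.1⟩, fun h => ⟨h.1.1, h.2, hg0⟩⟩
  rw [hphi, hfil, Finset.prod_filter, ← Finset.prod_sdiff
    (Nat.primeFactors_mono (Dvd.intro_left (q1 * q2) rfl : L ∣ q1 * q2 * L) hN0)]
  have hpg : ∀ p : ℕ, p.Prime → (p ∣ g ↔ (p ∣ q2 ∨ p ∣ R) ∧ (p ∣ q1 ∨ p ∣ L / R)) := by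
    intro p hp
    rw [hg, Nat.dvd_gcd_iff, hp.dvd_mul, hp.dvd_mul]
  congr 1
  · refine Finset.prod_congr rfl fun p hp => ?_
    rw [Finset.mem_sdiff] at hp
    have hpp := Nat.prime_of_mem_primeFactors hp.1
    have hpL : ¬ p ∣ L := fun h => hp.2 (Nat.mem_primeFactors.2 ⟨hpp, h, hL.ne'⟩)
    have e1 : ¬ p ∣ R := fun h => hpL (h.trans hR)
    have e2 : ¬ p ∣ L / R := fun h => hpL (h.trans (Nat.div_dvd_of_dvd hR))
    simp only [hpg p hpp, e1, e2, or_false]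
  · refine Finset.prod_congr rfl fun p hp => ?_
    have hpp := Nat.prime_of_mem_primeFactors hp
    have hl : L.factorization p ≠ 0 := by
      rwa [← Nat.support_factorization, Finsupp.mem_support_iff] at hp
    have hle : R.factorization p ≤ L.factorization p :=
      (Nat.factorization_le_iff_dvd hR0 hL.ne').2 hR p
    have e1 : p ∣ R ↔ R.factorization p ≠ 0 := by
      rw [hpp.dvd_iff_one_le_factorization hR0, Nat.one_le_iff_ne_zero]
    have e2 : p ∣ L / R ↔ R.factorization p ≠ L.factorization p := by
      rw [hpp.dvd_iff_one_le_factorization hLR0, Nat.factorization_div hR, Finsupp.tsub_apply]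
      omega
    unfold wLoc
    simp only [hpg p hpp, e1, e2]
    by_cases c1 : p ∣ q1 <;> by_cases c2 : p ∣ q2 <;>
      by_cases c3 : R.factorization p = 0 <;>
      by_cases c4 : R.factorization p = L.factorization p <;>
      first
      | (exfalso; omega)
      | simp [c1, c2, c3, c4, hl, hl.symm]

lemma IFun_prod {q1 q2 : ℕ} (χ1 : DirichletCharacter ℂ q1) (χ2 : DirichletCharacter ℂ q2)
    (t : ℝ) (L B1 B2 : ℕ) (hq1 : q1 ≠ 0) (hq2 : q2 ≠ 0) (hL : 0 < L)
    (hB1 : B1 ∣ L) (hB2 : B2 ∣ L) :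
    IFun χ1 χ2 t L B1 B2 = ((q1 * q2 * L : ℕ) : ℂ) *
      ((∏ p ∈ (q1 * q2 * L).primeFactors \ L.primeFactors,
        if p ∣ q2 ∧ p ∣ q1 then (1 - (p : ℂ)⁻¹) else 1) *
      ∏ p ∈ L.primeFactors, sLoc χ1 χ2 t p (L.factorization p) (B1.factorization p)
        (B2.factorization p)) := by
  unfold IFun sLoc
  rw [← sum_divisors_prod (fun p r => wLoc q1 q2 p (L.factorization p) r *
    (fHom χ1 t p ^ (r - B1.factorization p) * fHom χ2 t p ^ (B1.factorization p - r)) *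
    ((starRingEnd ℂ) (fHom χ1 t p) ^ (r - B2.factorization p) *
      (starRingEnd ℂ) (fHom χ2 t p) ^ (B2.factorization p - r))) L hL]
  congr 1
  rw [Finset.mul_sum]
  refine Finset.sum_congr rfl fun R hR => ?_
  have hR := (Nat.mem_divisors.1 hR).1
  rw [weight_prod q1 q2 L R hq1 hq2 hL hR, GFun_prod χ1 χ2 t L B1 R hL hB1 hR,
    GFun_prod χ1 χ2 t L B2 R hL hB2 hR, map_prod]
  simp only [map_mul, map_pow, Finset.prod_mul_distrib]
  ring

/-- Evaluation of the inner product of old-space Eisenstein series: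
`I(B1,B2)/I(1,1) = A(B2/(B1,B2)) conj(A(B1/(B1,B2)))`. -/
theorem inner_product_evaluation {q1 q2 : ℕ}
    (χ1 : DirichletCharacter ℂ q1) (χ2 : DirichletCharacter ℂ q2)
    (hprim1 : χ1.IsPrimitive) (hprim2 : χ2.IsPrimitive)
    (t : ℝ) (L : ℕ) (hL : 0 < L)
    (B1 B2 : ℕ) (hB1 : B1 ∣ L) (hB2 : B2 ∣ L) (hB1pos : 0 < B1) (hB2pos : 0 < B2) :
    IFun χ1 χ2 t L B1 B2 =
      IFun χ1 χ2 t L 1 1 * AChi χ1 χ2 t (B2 / Nat.gcd B1 B2) *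
        (starRingEnd ℂ) (AChi χ1 χ2 t (B1 / Nat.gcd B1 B2)) := by
  rcases eq_or_ne q1 0 with h1 | hq1
  · subst h1; simp [IFun]
  rcases eq_or_ne q2 0 with h2 | hq2
  · subst h2; simp [IFun]
  have d2 : B2 / Nat.gcd B1 B2 ∣ L := (Nat.div_dvd_of_dvd (Nat.gcd_dvd_right _ _)).trans hB2
  have d1 : B1 / Nat.gcd B1 B2 ∣ L := (Nat.div_dvd_of_dvd (Nat.gcd_dvd_left _ _)).trans hB1
  rw [IFun_prod χ1 χ2 t L B1 B2 hq1 hq2 hL hB1 hB2,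
    IFun_prod χ1 χ2 t L 1 1 hq1 hq2 hL (one_dvd _) (one_dvd _),
    AChi_prod χ1 χ2 t _ L hL.ne' d2, AChi_prod χ1 χ2 t _ L hL.ne' d1, map_prod]
  have key : ∀ p ∈ L.primeFactors,
      sLoc χ1 χ2 t p (L.factorization p) (B1.factorization p) (B2.factorization p) =
      sLoc χ1 χ2 t p (L.factorization p) (Nat.factorization 1 p) (Nat.factorization 1 p) *
        ALoc χ1 χ2 t p ((B2 / Nat.gcd B1 B2).factorization p) *
        (starRingEnd ℂ) (ALoc χ1 χ2 t p ((B1 / Nat.gcd B1 B2).factorization p)) := by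
    intro p hp
    rw [fact_div_gcd B1 B2 p hB1pos.ne' hB2pos.ne', Nat.gcd_comm,
      fact_div_gcd B2 B1 p hB2pos.ne' hB1pos.ne', Nat.factorization_one]
    exact sLoc_main χ1 χ2 t p _ _ _ (Nat.prime_of_mem_primeFactors hp)
      ((Nat.factorization_le_iff_dvd hB1pos.ne' hL.ne').2 hB1 p)
      ((Nat.factorization_le_iff_dvd hB2pos.ne' hL.ne').2 hB2 p)
  rw [Finset.prod_congr rfl key, Finset.prod_mul_distrib, Finset.prod_mul_distrib]
  ring
end

section
/- Let χ1 and χ2 be primitive Dirichlet characters modulo q1 and q2, let t ∈ ℝ, let L be a positive integer, and set N = q1·q2·L. With I(B1, B2) as defined below, for all positive divisors B1, B2 of L, writing g = gcd(B1, B2), one has I(B1, B2) = I(B1/g, B2/g). -/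
open Complex

/-- Closed form of `GFun`. -/
noncomputable def HFun {q1 q2 : ℕ} (χ1 : DirichletCharacter ℂ q1)
    (χ2 : DirichletCharacter ℂ q2) (t : ℝ) (B R : ℕ) : ℂ :=
  χ1 ((R / Nat.gcd R B : ℕ)) * χ2 ((B / Nat.gcd R B : ℕ)) *
    (((R / Nat.gcd R B * (B / Nat.gcd R B) : ℕ) : ℂ)) ^ (-(1 / 2 + I * t))

lemma gfun_cond {B R d e : ℕ} (hB : 0 < B) (hR : 0 < R) :
    (Nat.gcd d e = 1 ∧ B * d = R * e) ↔ (d = R / Nat.gcd R B ∧ e = B / Nat.gcd R B) := by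
  have hg : 0 < Nat.gcd R B := Nat.gcd_pos_of_pos_left _ hR
  obtain ⟨g, r, b, hg', hco, hr, hb⟩ := Nat.exists_coprime' (m := R) (n := B) hg
  have hgcd : Nat.gcd R B = g := by
    rw [hr, hb, Nat.gcd_mul_right, hco.gcd_eq_one, one_mul]
  rw [hgcd]
  have h1 : R / g = r := by rw [hr]; exact Nat.mul_div_cancel _ hg'
  have h2 : B / g = b := by rw [hb]; exact Nat.mul_div_cancel _ hg'
  rw [h1, h2]
  have hbpos : 0 < b := by
    rcases Nat.eq_zero_or_pos b with h | h
    · simp [h] at hb; omega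
    · exact h
  constructor
  · rintro ⟨hde, heq⟩
    have heq' : b * d = r * e := by
      apply Nat.eq_of_mul_eq_mul_left hg'
      calc g * (b * d) = (b * g) * d := by ring
        _ = (r * g) * e := by rw [← hb, ← hr, heq]
        _ = g * (r * e) := by ring
    have hbe : b ∣ e := hco.symm.dvd_of_dvd_mul_left (Dvd.intro _ heq')
    have heb : e ∣ b :=
      (Nat.Coprime.symm hde).dvd_of_dvd_mul_right (Dvd.intro_left _ heq'.symm)
    have e1 : e = b := Nat.dvd_antisymm heb hbe
    refine ⟨?_, e1⟩
    subst e1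
    apply Nat.eq_of_mul_eq_mul_left hbpos
    rw [heq', mul_comm]
  · rintro ⟨rfl, rfl⟩
    refine ⟨hco, ?_⟩
    rw [hr, hb]; ring

lemma gfun_eq {q1 q2 : ℕ} (χ1 : DirichletCharacter ℂ q1)
    (χ2 : DirichletCharacter ℂ q2) (t : ℝ) {L B R : ℕ} (hL : 0 < L) (hB : B ∣ L) (hR : R ∣ L) :
    GFun χ1 χ2 t L B R = HFun χ1 χ2 t B R := by
  have hBp : 0 < B := Nat.pos_of_dvd_of_pos hB hL
  have hRp : 0 < R := Nat.pos_of_dvd_of_pos hR hL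
  unfold GFun HFun
  simp only [gfun_cond hBp hRp]
  have hd : R / Nat.gcd R B ∈ (L / B).divisors := by
    rw [Nat.mem_divisors]
    refine ⟨?_, (Nat.div_pos (Nat.le_of_dvd hL hB) hBp).ne'⟩
    have h := Nat.lcm_dvd hR hB
    rw [Nat.dvd_div_iff_mul_dvd hB]
    convert h using 1
    rw [Nat.lcm, ← Nat.mul_div_assoc _ (Nat.gcd_dvd_left R B), mul_comm]
  have he : B / Nat.gcd R B ∈ B.divisors := by
    rw [Nat.mem_divisors]
    exact ⟨Nat.div_dvd_of_dvd (Nat.gcd_dvd_right R B), hBp.ne'⟩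
  rw [Finset.sum_eq_single_of_mem _ hd, Finset.sum_eq_single_of_mem _ he]
  · simp
  · intro b _ hb; simp [hb]
  · intro b _ hb; simp [hb]

lemma hfun_mul_mul {q1 q2 : ℕ} (χ1 : DirichletCharacter ℂ q1)
    (χ2 : DirichletCharacter ℂ q2) (t : ℝ) {p B R : ℕ} (hp : 0 < p) :
    HFun χ1 χ2 t (p * B) (p * R) = HFun χ1 χ2 t B R := by
  unfold HFun
  simp only [Nat.gcd_mul_left, Nat.mul_div_mul_left _ _ hp]

lemma hfun_mul_left {q1 q2 : ℕ} (χ1 : DirichletCharacter ℂ q1)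
    (χ2 : DirichletCharacter ℂ q2) (t : ℝ) {p B R : ℕ} (hp : p.Prime) (h : ¬ p ∣ R) :
    HFun χ1 χ2 t (p * B) R =
      (χ2 p * (p : ℂ) ^ (-(1 / 2 + I * t))) * HFun χ1 χ2 t B R := by
  have hg : Nat.gcd R (p * B) = Nat.gcd R B :=
    Nat.Coprime.gcd_mul_left_cancel_right B ((Nat.Prime.coprime_iff_not_dvd hp).2 h)
  unfold HFun
  rw [hg, Nat.mul_div_assoc _ (Nat.gcd_dvd_right R B)]
  rw [show R / R.gcd B * (p * (B / R.gcd B)) = p * (R / R.gcd B * (B / R.gcd B)) by ring]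
  rw [Nat.cast_mul p (R / R.gcd B * (B / R.gcd B)), natCast_mul_natCast_cpow, Nat.cast_mul p,
    map_mul]
  ring

lemma hfun_mul_right {q1 q2 : ℕ} (χ1 : DirichletCharacter ℂ q1)
    (χ2 : DirichletCharacter ℂ q2) (t : ℝ) {p B R M : ℕ} (hp : p.Prime) (h : ¬ p ∣ M)
    (hB : B ∣ R * M) :
    HFun χ1 χ2 t B (p * R) =
      (χ1 p * (p : ℂ) ^ (-(1 / 2 + I * t))) * HFun χ1 χ2 t B R := by
  have hg : Nat.gcd (p * R) B = Nat.gcd R B := by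
    apply Nat.dvd_antisymm
    · apply Nat.dvd_gcd _ (Nat.gcd_dvd_right _ _)
      have h1 : Nat.gcd (p * R) B ∣ Nat.gcd (R * p) (R * M) :=
        Nat.dvd_gcd (by rw [mul_comm R]; exact Nat.gcd_dvd_left _ _)
          ((Nat.gcd_dvd_right _ _).trans hB)
      rwa [Nat.gcd_mul_left, ((Nat.Prime.coprime_iff_not_dvd hp).2 h).gcd_eq_one, mul_one] at h1
    · exact Nat.gcd_dvd_gcd_mul_left_left _ _ _
  unfold HFun
  rw [hg, Nat.mul_div_assoc _ (Nat.gcd_dvd_left R B)]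
  rw [mul_assoc p]
  rw [Nat.cast_mul p (R / R.gcd B * (B / R.gcd B)), natCast_mul_natCast_cpow, Nat.cast_mul p,
    map_mul]
  ring

lemma char_sq {q : ℕ} (χ : DirichletCharacter ℂ q) (t : ℝ) {p : ℕ} (hp : p.Prime) :
    (χ p * (p : ℂ) ^ (-(1 / 2 + I * t))) *
      (starRingEnd ℂ) (χ p * (p : ℂ) ^ (-(1 / 2 + I * t))) =
      if p ∣ q then 0 else (p : ℂ)⁻¹ := by
  rw [Complex.mul_conj, Complex.normSq_eq_norm_sq, norm_mul,
    Complex.norm_natCast_cpow_of_pos hp.pos]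
  split_ifs with h
  · have : ¬ IsUnit ((p : ℕ) : ZMod q) := by
      rw [ZMod.isUnit_iff_coprime]
      intro hc
      exact (Nat.Prime.coprime_iff_not_dvd hp).1 hc h
    rw [χ.map_nonunit this]; simp
  · have : IsUnit ((p : ℕ) : ZMod q) := by
      rw [ZMod.isUnit_iff_coprime]
      exact (Nat.Prime.coprime_iff_not_dvd hp).2 h
    obtain ⟨u, hu⟩ := this
    rw [← hu, DirichletCharacter.unit_norm_eq_one, one_mul, ← Real.rpow_natCast,
      ← Real.rpow_mul (Nat.cast_nonneg p)]
    have : (-(1 / 2 + I * (t : ℂ))).re * ((2 : ℕ) : ℝ) = -1 := by simp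
    rw [this, Real.rpow_neg_one]
    push_cast; rfl

lemma psi_eq {n : ℕ} (hn : n ≠ 0) :
    (Nat.totient n : ℂ) / ((n : ℕ) : ℂ) = ∏ p ∈ n.primeFactors, (1 - (p : ℂ)⁻¹) := by
  have h := Nat.totient_eq_mul_prod_factors n
  have h' : (Nat.totient n : ℂ) = n * ∏ p ∈ n.primeFactors, (1 - (p : ℂ)⁻¹) := by
    have := congrArg (fun x : ℚ => (x : ℂ)) h
    push_cast at this
    exact this
  rw [h']
  field_simp

lemma psi_gcd {p a b : ℕ} (hp : p.Prime) (ha : a ≠ 0) (hb : b ≠ 0) :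
    (Nat.totient (Nat.gcd a (p * b)) : ℂ) / ((Nat.gcd a (p * b) : ℕ) : ℂ) *
      (1 - if p ∣ a then 0 else (p : ℂ)⁻¹) =
    ∏ l ∈ insert p (Nat.gcd a b).primeFactors, (1 - (l : ℂ)⁻¹) := by
  rw [psi_eq (Nat.gcd_ne_zero_left ha)]
  split_ifs with h
  · rw [sub_zero, mul_one]
    apply Finset.prod_congr _ (fun _ _ => rfl)
    ext l
    simp only [Nat.mem_primeFactors, Finset.mem_insert, Nat.dvd_gcd_iff, ne_eq,
      Nat.gcd_eq_zero_iff]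
    constructor
    · rintro ⟨hl, ⟨h1, h2⟩, -⟩
      rcases hl.dvd_mul.1 h2 with h3 | h3
      · exact Or.inl ((Nat.prime_dvd_prime_iff_eq hl hp).1 h3)
      · exact Or.inr ⟨hl, ⟨h1, h3⟩, by tauto⟩
    · rintro (rfl | ⟨hl, ⟨h1, h2⟩, -⟩)
      · exact ⟨hp, ⟨h, dvd_mul_right _ _⟩, by tauto⟩
      · exact ⟨hl, ⟨h1, h2.mul_left _⟩, by tauto⟩
  · rw [Nat.Coprime.gcd_mul_left_cancel_right b ((Nat.Prime.coprime_iff_not_dvd hp).2 h),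
      Finset.prod_insert, mul_comm]
    intro hc
    exact h ((Nat.dvd_of_mem_primeFactors hc).trans (Nat.gcd_dvd_left _ _))

lemma sum_div_a (p K : ℕ) (hp : p.Prime) (hK : 0 < K) (F : ℕ → ℂ) :
    ∑ R ∈ (p * K).divisors, F R =
      ∑ R ∈ K.divisors, (F R + if p ∣ K / R then 0 else F (p * R)) := by
  have hpK : p * K ≠ 0 := Nat.mul_ne_zero hp.ne_zero hK.ne'
  have hset : (p * K).divisors =
      K.divisors ∪ (K.divisors.filter (fun R => ¬ p ∣ K / R)).image (fun R => p * R) := by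
    ext R
    simp only [Finset.mem_union, Finset.mem_image, Finset.mem_filter, Nat.mem_divisors]
    constructor
    · rintro ⟨h, -⟩
      by_cases hR : R ∣ K
      · exact Or.inl ⟨hR, hK.ne'⟩
      · right
        have hpR : p ∣ R := by
          by_contra hc
          exact hR (((Nat.Prime.coprime_iff_not_dvd hp).2 hc).symm.dvd_of_dvd_mul_left h)
        obtain ⟨S, rfl⟩ := hpR
        have hS : S ∣ K := Nat.dvd_of_mul_dvd_mul_left hp.pos h
        refine ⟨S, ⟨⟨hS, hK.ne'⟩, ?_⟩, rfl⟩
        rw [Nat.dvd_div_iff_mul_dvd hS, mul_comm]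
        exact hR
    · rintro (⟨h, -⟩ | ⟨S, ⟨⟨hS, -⟩, -⟩, rfl⟩)
      · exact ⟨h.mul_left _, hpK⟩
      · exact ⟨Nat.mul_dvd_mul_left _ hS, hpK⟩
  rw [hset, Finset.sum_union, Finset.sum_image, Finset.sum_add_distrib, Finset.sum_filter]
  · congr 1
    apply Finset.sum_congr rfl
    intro R _
    by_cases h : p ∣ K / R <;> simp [h]
  · intro x _ y _ h
    exact Nat.eq_of_mul_eq_mul_left hp.pos h
  · rw [Finset.disjoint_left]
    intro R h1 h2
    simp only [Finset.mem_image, Finset.mem_filter, Nat.mem_divisors] at h1 h2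
    obtain ⟨S, ⟨⟨hS, -⟩, hn⟩, rfl⟩ := h2
    apply hn
    rw [Nat.dvd_div_iff_mul_dvd hS, mul_comm]
    exact h1.1

lemma sum_div_b (p K : ℕ) (hp : p.Prime) (hK : 0 < K) (F : ℕ → ℂ) :
    ∑ R ∈ (p * K).divisors, F R =
      ∑ R ∈ K.divisors, (F (p * R) + if p ∣ R then 0 else F R) := by
  rw [← Nat.sum_div_divisors (p * K) F, sum_div_a p K hp hK,
    ← Nat.sum_div_divisors K (fun R => F (p * R) + if p ∣ R then 0 else F R)]
  apply Finset.sum_congr rfl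
  intro R hR
  have hR' := (Nat.mem_divisors.1 hR).1
  rw [Nat.mul_div_assoc _ hR', Nat.mul_div_mul_left _ _ hp.pos]

lemma ifun_step {q1 q2 : ℕ} (χ1 : DirichletCharacter ℂ q1) (χ2 : DirichletCharacter ℂ q2)
    (t : ℝ) {p K B1 B2 : ℕ} (hp : p.Prime) (hK : 0 < K) (hB1 : B1 ∣ K) (hB2 : B2 ∣ K) :
    IFun χ1 χ2 t (p * K) (p * B1) (p * B2) = IFun χ1 χ2 t (p * K) B1 B2 := by
  have hpK : 0 < p * K := Nat.mul_pos hp.pos hK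
  unfold IFun
  rcases Nat.eq_zero_or_pos q1 with h1 | h1
  · simp [h1]
  rcases Nat.eq_zero_or_pos q2 with h2 | h2
  · simp [h2]
  congr 1
  have key : ∀ C1 C2 : ℕ, C1 ∣ p * K → C2 ∣ p * K →
      ∑ R ∈ (p * K).divisors,
        ((Nat.totient (Nat.gcd (q2 * R) (q1 * ((p * K) / R))) : ℂ) /
        ((Nat.gcd (q2 * R) (q1 * ((p * K) / R)) : ℕ) : ℂ)) *
      GFun χ1 χ2 t (p * K) C1 R * (starRingEnd ℂ) (GFun χ1 χ2 t (p * K) C2 R) =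
      ∑ R ∈ (p * K).divisors,
        ((Nat.totient (Nat.gcd (q2 * R) (q1 * ((p * K) / R))) : ℂ) /
        ((Nat.gcd (q2 * R) (q1 * ((p * K) / R)) : ℕ) : ℂ)) *
      HFun χ1 χ2 t C1 R * (starRingEnd ℂ) (HFun χ1 χ2 t C2 R) := by
    intro C1 C2 hC1 hC2
    apply Finset.sum_congr rfl
    intro R hR
    have hR' := (Nat.mem_divisors.1 hR).1
    rw [gfun_eq χ1 χ2 t hpK hC1 hR', gfun_eq χ1 χ2 t hpK hC2 hR']
  rw [key _ _ (Nat.mul_dvd_mul_left _ hB1) (Nat.mul_dvd_mul_left _ hB2),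
    key _ _ (hB1.mul_left _) (hB2.mul_left _), sum_div_b p K hp hK, sum_div_a p K hp hK]
  apply Finset.sum_congr rfl
  intro R hR
  obtain ⟨M, rfl⟩ := (Nat.mem_divisors.1 hR).1
  have hRp : 0 < R := Nat.pos_of_mul_pos_right hK
  have hMp : 0 < M := Nat.pos_of_mul_pos_left hK
  have e1 : p * (R * M) / (p * R) = M := by
    rw [← mul_assoc]; exact Nat.mul_div_cancel_left _ (Nat.mul_pos hp.pos hRp)
  have e2 : p * (R * M) / R = p * M := by
    rw [mul_left_comm]; exact Nat.mul_div_cancel_left _ hRp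
  have e3 : R * M / R = M := Nat.mul_div_cancel_left _ hRp
  rw [e1, e2, e3]
  simp only [hfun_mul_mul χ1 χ2 t hp.pos]
  have k1 := psi_gcd (a := q2 * R) (b := q1 * M) hp (by positivity) (by positivity)
  have k2 := psi_gcd (a := q1 * M) (b := q2 * R) hp (by positivity) (by positivity)
  rw [Nat.gcd_comm (q1 * M) (q2 * R), ← k1, Nat.gcd_comm] at k2
  rw [show q1 * (p * M) = p * (q1 * M) by ring, show q2 * (p * R) = p * (q2 * R) by ring]
  simp only [hp.dvd_mul] at k2
  have c1 := char_sq χ1 t hp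
  have c2 := char_sq χ2 t hp
  set w := (Nat.totient (Nat.gcd (q2 * R) (p * (q1 * M))) : ℂ) /
    ((Nat.gcd (q2 * R) (p * (q1 * M)) : ℕ) : ℂ)
  set w' := (Nat.totient (Nat.gcd (p * (q2 * R)) (q1 * M)) : ℂ) /
    ((Nat.gcd (p * (q2 * R)) (q1 * M) : ℕ) : ℂ)
  have t1 : (if p ∣ R then 0 else w * HFun χ1 χ2 t (p * B1) R *
      (starRingEnd ℂ) (HFun χ1 χ2 t (p * B2) R)) =
      w * HFun χ1 χ2 t B1 R * (starRingEnd ℂ) (HFun χ1 χ2 t B2 R) *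
        (if p ∣ q2 ∨ p ∣ R then 0 else (p : ℂ)⁻¹) := by
    by_cases h : p ∣ R
    · simp [h]
    · simp only [h, if_false, or_false]
      rw [hfun_mul_left χ1 χ2 t hp h, hfun_mul_left χ1 χ2 t hp h, ← c2,
        map_mul _ _ (HFun χ1 χ2 t B2 R)]
      ring
  have t2 : (if p ∣ M then 0 else w' * HFun χ1 χ2 t B1 (p * R) *
      (starRingEnd ℂ) (HFun χ1 χ2 t B2 (p * R))) =
      w' * HFun χ1 χ2 t B1 R * (starRingEnd ℂ) (HFun χ1 χ2 t B2 R) *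
        (if p ∣ q1 ∨ p ∣ M then 0 else (p : ℂ)⁻¹) := by
    by_cases h : p ∣ M
    · simp [h]
    · simp only [h, if_false, or_false]
      rw [hfun_mul_right χ1 χ2 t hp h hB1, hfun_mul_right χ1 χ2 t hp h hB2, ← c1,
        map_mul _ _ (HFun χ1 χ2 t B2 R)]
      ring
  rw [t1, t2]
  linear_combination (HFun χ1 χ2 t B1 R * (starRingEnd ℂ) (HFun χ1 χ2 t B2 R)) * k2

lemma ifun_mul {q1 q2 : ℕ} (χ1 : DirichletCharacter ℂ q1) (χ2 : DirichletCharacter ℂ q2)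
    (t : ℝ) {L : ℕ} (hL : 0 < L) (g : ℕ) : ∀ B1 B2 : ℕ, g * B1 ∣ L → g * B2 ∣ L →
    IFun χ1 χ2 t L (g * B1) (g * B2) = IFun χ1 χ2 t L B1 B2 := by
  induction g using induction_on_primes with
  | zero =>
    intro B1 B2 h1 _
    simp at h1; omega
  | one => intro B1 B2 _ _; simp
  | prime_mul p a hp ih =>
    intro B1 B2 h1 h2
    rw [mul_assoc] at h1 h2
    rw [mul_assoc, mul_assoc, ← ih B1 B2 ((dvd_mul_left _ _).trans h1)
      ((dvd_mul_left _ _).trans h2)]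
    obtain ⟨K, rfl⟩ := (dvd_mul_right p _).trans h1
    exact ifun_step χ1 χ2 t hp (Nat.pos_of_mul_pos_left hL)
      (Nat.dvd_of_mul_dvd_mul_left hp.pos h1) (Nat.dvd_of_mul_dvd_mul_left hp.pos h2)

/-- The inner product `I(B1,B2)` is unchanged when both arguments are divided by their gcd. -/
theorem inner_product_gcd_reduction {q1 q2 : ℕ}
    (χ1 : DirichletCharacter ℂ q1) (χ2 : DirichletCharacter ℂ q2)
    (hprim1 : χ1.IsPrimitive) (hprim2 : χ2.IsPrimitive)
    (t : ℝ) (L : ℕ) (hL : 0 < L)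
    (B1 B2 : ℕ) (hB1 : B1 ∣ L) (hB2 : B2 ∣ L) (hB1pos : 0 < B1) (hB2pos : 0 < B2) :
    IFun χ1 χ2 t L B1 B2 = IFun χ1 χ2 t L (B1 / Nat.gcd B1 B2) (B2 / Nat.gcd B1 B2) := by
  have e1 := Nat.mul_div_cancel' (Nat.gcd_dvd_left B1 B2)
  have e2 := Nat.mul_div_cancel' (Nat.gcd_dvd_right B1 B2)
  have h := ifun_mul χ1 χ2 t hL (Nat.gcd B1 B2) (B1 / Nat.gcd B1 B2) (B2 / Nat.gcd B1 B2)
    (by rw [e1]; exact hB1) (by rw [e2]; exact hB2)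
  rwa [e1, e2] at h
end
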